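/- Let ω and ρ be normal hermitian functionals on a von Neumann algebra R with center Z. There exists a normal unital completely positive map ψ: R → R lying in the point-weak* closure of E(R) and satisfying ω∘ψ = ρ if and only if ρ|Z = ω|Z and ‖cρ‖ ≤ ‖cω‖ for every positive c ∈ Z. Under this condition, ρ lies in the norm closure of the set ω∘E(R) = {ω∘φ : φ ∈ E(R)}. -/

import Mathlib

universe u

open scoped ComplexConjugate ComplexOrder

noncomputable section

variable {H : Type u} [NormedAddCommGroup H] [InnerProductSpace ℂ H] [CompleteSpace H]

local notation "⟪" x ", " y "⟫" => @inner ℂ _ _ x y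

namespace VonNeumannAlgebraPaper

/-- Scalar multiples of elements of a von Neumann algebra stay in it. -/
instance : SMulMemClass (VonNeumannAlgebra H) ℂ (H →L[ℂ] H) where
  smul_mem {S} z x hx := by
    have h : z • x = algebraMap ℂ (H →L[ℂ] H) z * x := Algebra.smul_def z x
    rw [h]
    exact mul_mem (S.toStarSubalgebra.algebraMap_mem z) hx

instance (M : VonNeumannAlgebra H) : Algebra ℂ ↥M :=
  Algebra.ofModule
    (fun r x y => Subtype.ext (smul_mul_assoc r (x : H →L[ℂ] H) (y : H →L[ℂ] H)))
    (fun r x y => Subtype.ext (mul_smul_comm r (x : H →L[ℂ] H) (y : H →L[ℂ] H)))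

instance (M : VonNeumannAlgebra H) : NormedAlgebra ℂ ↥M where
  norm_smul_le r x := norm_smul_le r (x : H →L[ℂ] H)

variable {M : VonNeumannAlgebra H}

/-- A linear functional on `M` is positive if it is nonnegative on all
elements `a* a`. -/
def IsPositiveFunctional (ω : ↥M →L[ℂ] ℂ) : Prop :=
  ∀ a : ↥M, 0 ≤ ω (star a * a)

/-- A state is a positive unital linear functional. -/
def IsState (ω : ↥M →L[ℂ] ℂ) : Prop :=
  IsPositiveFunctional ω ∧ ω 1 = 1

/-- A hermitian (self-adjoint) linear functional. -/
def IsHermitianFunctional (ω : ↥M →L[ℂ] ℂ) : Prop :=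
  ∀ a : ↥M, ω (star a) = conj (ω a)

/-- `ωp`, `ωm` form the Jordan decomposition of the hermitian functional `ω`. -/
def IsJordanDecomposition (ω ωp ωm : ↥M →L[ℂ] ℂ) : Prop :=
  IsPositiveFunctional ωp ∧ IsPositiveFunctional ωm ∧ ω = ωp - ωm ∧ ‖ω‖ = ‖ωp‖ + ‖ωm‖

/-- An element of a C*-algebra is positive iff it is of the form `b* b`. -/
def IsPositiveElem (c : ↥M) : Prop :=
  ∃ b : ↥M, c = star b * b

/-- A normal (= weak* continuous) functional on the von Neumann algebra `M`:
it is given by a pair of ℓ²-sequences of vectors. -/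
def IsNormalFunctional (ω : ↥M →L[ℂ] ℂ) : Prop :=
  ∃ x y : ℕ → H, Summable (fun n => ‖x n‖ ^ 2) ∧ Summable (fun n => ‖y n‖ ^ 2) ∧
    ∀ a : ↥M, HasSum (fun n => ⟪x n, (a : H →L[ℂ] H) (y n)⟫) (ω a)

/-- `E(M)`: the unital completely positive elementary maps
`x ↦ ∑ i, (a i)* x (a i)` with `∑ i, (a i)* (a i) = 1`. -/
def IsElementaryUCP (φ : ↥M →L[ℂ] ↥M) : Prop :=
  ∃ (n : ℕ) (a : Fin n → ↥M), (∑ i, star (a i) * a i) = 1 ∧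
    ∀ x : ↥M, φ x = ∑ i, star (a i) * x * a i

/-- The set `ω ∘ E(M) = {ω ∘ φ : φ ∈ E(M)}`. -/
def mixSet (ω : ↥M →L[ℂ] ℂ) : Set (↥M →L[ℂ] ℂ) :=
  {ρ | ∃ φ : ↥M →L[ℂ] ↥M, IsElementaryUCP φ ∧ ρ = ω.comp φ}

/-- Membership in the weak* closure of a set of functionals on `M`. -/
def InWeakStarClosure (S : Set (↥M →L[ℂ] ℂ)) (ρ : ↥M →L[ℂ] ℂ) : Prop :=
  ∀ ε : ℝ, 0 < ε → ∀ (n : ℕ) (x : Fin n → ↥M), ∃ σ ∈ S, ∀ i, ‖ρ (x i) - σ (x i)‖ < ε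

/-- Membership in the point-weak* closure of a set `S` of maps on `M`: at
finitely many points, finitely many normal functionals are simultaneously
approximated by some member of `S`. -/
def InPointWeakStarClosure (S : Set (↥M →L[ℂ] ↥M)) (ψ : ↥M →L[ℂ] ↥M) : Prop :=
  ∀ ε : ℝ, 0 < ε → ∀ (n : ℕ) (x : Fin n → ↥M) (g : Fin n → (↥M →L[ℂ] ℂ)),
    (∀ i, IsNormalFunctional (g i)) →
    ∃ φ ∈ S, ∀ i j, ‖g i (ψ (x j)) - g i (φ (x j))‖ < ε

/-- A map on `M` is normal if pre-composition preserves normal functionals. -/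
def IsNormalMap (ψ : ↥M →L[ℂ] ↥M) : Prop :=
  ∀ ω : ↥M →L[ℂ] ℂ, IsNormalFunctional ω → IsNormalFunctional (ω.comp ψ)

/-- Complete positivity of a map on `M`. -/
def IsCompletelyPositiveMap (ψ : ↥M →L[ℂ] ↥M) : Prop :=
  ∀ (n : ℕ) (a : Fin n → ↥M) (v : Fin n → H),
    0 ≤ ∑ i, ∑ j, ⟪v i, ((ψ (star (a i) * a j) : ↥M) : H →L[ℂ] H) (v j)⟫

/-- The norm `‖cω‖` of the functional `x ↦ ω (c * x)`. -/
def mulNorm (ω : ↥M →L[ℂ] ℂ) (c : ↥M) : ℝ :=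
  sSup {r : ℝ | ∃ x : ↥M, ‖x‖ ≤ 1 ∧ r = ‖ω (c * x)‖}

/-- Norm-closed two-sided ideals of `M`. -/
def IsClosedIdeal (J : Set ↥M) : Prop :=
  IsClosed J ∧ (0 : ↥M) ∈ J ∧ (∀ x ∈ J, ∀ y ∈ J, x + y ∈ J) ∧
    (∀ (c : ℂ), ∀ x ∈ J, c • x ∈ J) ∧ (∀ (a : ↥M), ∀ x ∈ J, a * x ∈ J ∧ x * a ∈ J)

/-- The norm `‖ω|J‖` of the restriction of a functional `ω` to a subset `J`. -/
def normRestrict (ω : ↥M →L[ℂ] ℂ) (J : Set ↥M) : ℝ :=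
  sSup {r : ℝ | ∃ x ∈ J, ‖x‖ ≤ 1 ∧ r = ‖ω x‖}

/-- Maximal (norm-closed two-sided) ideals of `M`. -/
def IsMaximalIdeal (N : Set ↥M) : Prop :=
  IsClosedIdeal N ∧ N ≠ Set.univ ∧
    ∀ N' : Set ↥M, IsClosedIdeal N' → N' ≠ Set.univ → N ⊆ N' → N' = N

/-- The strong radical of `M`: the intersection of all maximal ideals. -/
def strongRadical (M : VonNeumannAlgebra H) : Set ↥M :=
  ⋂₀ {N : Set ↥M | IsMaximalIdeal N}

/-- A state `ω` is maximally mixed if every state `ρ` in the weak* closure of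
`ω ∘ E(M)` satisfies in turn that `ω` is in the weak* closure of `ρ ∘ E(M)`. -/
def IsMaximallyMixed (ω : ↥M →L[ℂ] ℂ) : Prop :=
  IsState ω ∧ ∀ ρ : ↥M →L[ℂ] ℂ, IsState ρ →
    InWeakStarClosure (mixSet ω) ρ → InWeakStarClosure (mixSet ρ) ω


set_option linter.unusedSectionVars false

section Generic

variable {A : Type*} [CStarAlgebra A] [PartialOrder A] [StarOrderedRing A]

/-- Positivity of a functional on a C*-algebra. -/
def Pos (f : A →L[ℂ] ℂ) : Prop := ∀ a : A, 0 ≤ f (star a * a)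

lemma Pos.nonneg {f : A →L[ℂ] ℂ} (hf : Pos f) {x : A} (hx : 0 ≤ x) : 0 ≤ f x := by
  obtain ⟨b, rfl⟩ := CStarAlgebra.nonneg_iff_eq_star_mul_self.mp hx
  exact hf b

def Pos.toPLM {f : A →L[ℂ] ℂ} (hf : Pos f) : A →ₚ[ℂ] ℂ :=
  PositiveLinearMap.mk₀ f.toLinearMap (fun _ hx => hf.nonneg hx)

lemma Pos.toPLM_apply {f : A →L[ℂ] ℂ} (hf : Pos f) (x : A) : hf.toPLM x = f x := rfl

lemma Pos.herm {f : A →L[ℂ] ℂ} (hf : Pos f) (x : A) : f (star x) = conj (f x) := by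
  have := map_star hf.toPLM x
  exact this

lemma Pos.cs {f : A →L[ℂ] ℂ} (hf : Pos f) (a b : A) :
    ‖f (star a * b)‖ ^ 2 ≤ (f (star a * a)).re * (f (star b * b)).re := by
  have h := norm_inner_le_norm (𝕜 := ℂ) (hf.toPLM.toPreGNS a) (hf.toPLM.toPreGNS b)
  rw [PositiveLinearMap.preGNS_inner_def] at h
  have h2 := pow_le_pow_left₀ (norm_nonneg _) h 2
  rw [mul_pow] at h2
  have e1 := PositiveLinearMap.preGNS_norm_sq hf.toPLM (hf.toPLM.toPreGNS a)
  have e2 := PositiveLinearMap.preGNS_norm_sq hf.toPLM (hf.toPLM.toPreGNS b)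
  simp only [PositiveLinearMap.ofPreGNS_toPreGNS, hf.toPLM_apply] at h2 e1 e2
  rw [← e1, ← e2]
  exact_mod_cast h2

lemma Pos.re_nonneg {f : A →L[ℂ] ℂ} (hf : Pos f) {x : A} (hx : 0 ≤ x) : 0 ≤ (f x).re :=
  (Complex.le_def.mp (hf.nonneg hx)).1

lemma Pos.mono {f : A →L[ℂ] ℂ} (hf : Pos f) {x y : A} (h : x ≤ y) : (f x).re ≤ (f y).re := by
  have := hf.re_nonneg (sub_nonneg.mpr h)
  rw [map_sub, Complex.sub_re] at this
  linarith

lemma map_rsmul (f : A →L[ℂ] ℂ) (r : ℝ) (x : A) : f (r • x) = r * f x := by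
  rw [← Complex.coe_smul, map_smul, smul_eq_mul]

lemma hermitian_im {f : A →L[ℂ] ℂ} (hf : ∀ a, f (star a) = conj (f a)) {x : A}
    (hx : IsSelfAdjoint x) : (f x).im = 0 := by
  have := hf x
  rw [hx.star_eq] at this
  exact Complex.conj_eq_iff_im.mp this.symm

lemma Pos.real {f : A →L[ℂ] ℂ} (hf : Pos f) {x : A} (hx : IsSelfAdjoint x) :
    ((f x).re : ℂ) = f x :=
  Complex.ext (by simp) (by simp [hermitian_im hf.herm hx])

/-- the regularised fourth root -/
lemma exists_reg {w : A} (hw : 0 ≤ w) {ε : ℝ} (hε : 0 < ε) :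
    ∃ a a' : A, IsSelfAdjoint a ∧ IsSelfAdjoint a' ∧ a * a' = 1 ∧ a' * a = 1 ∧
      a * a * (a * a) = w + (ε ^ 2) • (1 : A) ∧ ε • (a' * a') ≤ 1 ∧
      ∀ y, Commute w y → Commute a y ∧ Commute a' y := by
  have hws : IsSelfAdjoint w := IsSelfAdjoint.of_nonneg hw
  set k : ℝ → ℝ := fun t => √(√(|t| + ε ^ 2)) with hk
  have hkc : Continuous k := by fun_prop
  have hkp : ∀ t, 0 < k t := fun t => by
    apply Real.sqrt_pos.mpr; apply Real.sqrt_pos.mpr; positivity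
  have hkc' : Continuous (fun t => (k t)⁻¹) := hkc.inv₀ (fun t => (hkp t).ne')
  have hk4 : ∀ t, k t * k t * (k t * k t) = |t| + ε ^ 2 := fun t => by
    simp only [hk]
    rw [Real.mul_self_sqrt (by positivity), Real.mul_self_sqrt (by positivity)]
  have hk2 : ∀ t, ε * ((k t)⁻¹ * (k t)⁻¹) ≤ 1 := fun t => by
    rw [← mul_inv, ← div_eq_mul_inv, div_le_one (mul_pos (hkp t) (hkp t))]
    simp only [hk]
    rw [Real.mul_self_sqrt (by positivity)]
    apply Real.le_sqrt_of_sq_le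
    nlinarith [abs_nonneg t]
  refine ⟨cfc k w, cfc (fun t => (k t)⁻¹) w, cfc_predicate _ _, cfc_predicate _ _, ?_, ?_, ?_, ?_,
    fun y hy => ⟨hy.cfc_real _, hy.cfc_real _⟩⟩
  · rw [← cfc_mul _ _ w hkc.continuousOn hkc'.continuousOn]
    rw [cfc_congr (g := fun _ => (1:ℝ)) (fun t _ => mul_inv_cancel₀ (hkp t).ne')]
    exact cfc_const_one ℝ w
  · rw [← cfc_mul _ _ w hkc'.continuousOn hkc.continuousOn]
    rw [cfc_congr (g := fun _ => (1:ℝ)) (fun t _ => inv_mul_cancel₀ (hkp t).ne')]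
    exact cfc_const_one ℝ w
  · have hkk : Continuous (fun t => k t * k t) := hkc.mul hkc
    rw [← cfc_mul k k w hkc.continuousOn hkc.continuousOn,
      ← cfc_mul (fun t => k t * k t) (fun t => k t * k t) w hkk.continuousOn hkk.continuousOn]
    rw [cfc_congr (g := fun t => t + ε ^ 2) (fun t ht => by
      simp only [hk4]; rw [abs_of_nonneg (spectrum_nonneg_of_nonneg hw ht)])]
    rw [cfc_add_const (ε ^ 2) (fun t => t) w, cfc_id' ℝ w, Algebra.algebraMap_eq_smul_one]
  · have hkk : Continuous (fun t => (k t)⁻¹ * (k t)⁻¹) := hkc'.mul hkc'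
    rw [← cfc_mul _ _ w hkc'.continuousOn hkc'.continuousOn, ← cfc_smul ε
      (fun t => (k t)⁻¹ * (k t)⁻¹) w hkk.continuousOn]
    exact cfc_le_one _ w (fun t _ => by simpa using hk2 t)

lemma star_mul_mul_le (x b : A) : star b * (star x * x) * b ≤ (‖x‖ ^ 2) • (star b * b) := by
  have := CStarAlgebra.star_left_conjugate_le_norm_smul (a := b) (b := star x * x)
    (IsSelfAdjoint.star_mul_self x)
  rwa [CStarRing.norm_star_mul_self, ← sq] at this

/-- If `f(1) = ‖f‖` then `f` is positive. -/
lemma pos_of_norm_le {f : A →L[ℂ] ℂ} {N : ℝ} (h1 : f 1 = N) (hN : ‖f‖ ≤ N) : Pos f := by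
  have hN0 : 0 ≤ N := (norm_nonneg f).trans hN
  have key : ∀ h : A, IsSelfAdjoint h → (f h).im = 0 := by
    intro h hh
    have hb : ∀ t : ℝ, ((f h).im + t * N) ^ 2 ≤ N ^ 2 * (‖h‖ ^ 2 + t ^ 2) := by
      intro t
      set u : A := h + ((t:ℂ) * Complex.I) • (1 : A) with hu
      have e1 : (f u).im = (f h).im + t * N := by
        rw [hu, map_add, map_smul, h1]; simp
      have e2 : ‖u‖ ^ 2 ≤ ‖h‖ ^ 2 + t ^ 2 := by
        have : star u * u = h * h + (t ^ 2) • (1 : A) := by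
          rw [hu, star_add, hh.star_eq, star_smul, star_one]
          have : star ((t:ℂ) * Complex.I) = - ((t:ℂ) * Complex.I) := by simp
          rw [this]
          have hI : ((t ^ 2 : ℝ) : ℂ) = -(((t:ℂ) * Complex.I) * ((t:ℂ) * Complex.I)) := by
            push_cast; ring_nf; simp
          rw [← Complex.coe_smul (t ^ 2) (1 : A), hI]
          generalize (t:ℂ) * Complex.I = w at *
          simp only [add_mul, mul_add, smul_mul_assoc, mul_smul_comm, one_mul, mul_one, neg_smul,
            neg_mul, smul_add, smul_smul, smul_neg]
          abel
        rw [sq, ← CStarRing.norm_star_mul_self, this]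
        refine (norm_add_le _ _).trans (add_le_add ?_ ?_)
        · rw [sq]; exact norm_mul_le _ _
        · refine (norm_smul_le _ _).trans ?_
          rw [Real.norm_eq_abs, abs_of_nonneg (sq_nonneg t)]
          have h11 : ‖(1 : A)‖ ≤ 1 := by
            have := CStarRing.norm_self_mul_star (x := (1 : A))
            rw [star_one, mul_one] at this
            nlinarith [norm_nonneg (1 : A)]
          nlinarith [sq_nonneg t]
      have e3 : |(f u).im| ≤ N * ‖u‖ :=
        (Complex.abs_im_le_norm _).trans ((f.le_opNorm u).trans
          (mul_le_mul_of_nonneg_right hN (norm_nonneg _)))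
      rw [← e1, ← sq_abs]
      calc |(f u).im| ^ 2 ≤ (N * ‖u‖) ^ 2 := pow_le_pow_left₀ (abs_nonneg _) e3 2
        _ = N ^ 2 * ‖u‖ ^ 2 := by ring
        _ ≤ _ := mul_le_mul_of_nonneg_left e2 (sq_nonneg _)
    rcases hN0.eq_or_lt with h0 | hpos
    · have : ‖f h‖ ≤ 0 := by
        refine (f.le_opNorm h).trans ?_
        have : ‖f‖ ≤ 0 := by rw [h0]; exact hN
        nlinarith [norm_nonneg h, norm_nonneg f]
      rw [norm_le_zero_iff.mp this]; simp
    · by_contra hne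
      set β := (f h).im
      have := hb ((N ^ 2 * ‖h‖ ^ 2 + 1) / (2 * β * N))
      have e : 2 * β * ((N ^ 2 * ‖h‖ ^ 2 + 1) / (2 * β * N)) * N = N ^ 2 * ‖h‖ ^ 2 + 1 := by
        field_simp
      nlinarith [sq_nonneg β]
  -- now positivity
  have key2 : ∀ x : A, 0 ≤ x → ‖x‖ ≤ 1 → 0 ≤ (f x).re := by
    intro x hx hx1
    have hx2 : x ≤ 1 := (CStarAlgebra.norm_le_one_iff_of_nonneg x hx).mp hx1
    have h3 : ‖1 - x‖ ≤ 1 := (CStarAlgebra.norm_le_one_iff_of_nonneg (1 - x)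
      (sub_nonneg.mpr hx2)).mpr (by simpa using hx)
    have h4 : ‖f (1 - x)‖ ≤ N := by
      refine (f.le_opNorm _).trans ?_
      nlinarith [norm_nonneg f, norm_nonneg (1 - x)]
    have h5 := (Complex.re_le_norm _).trans h4
    rw [map_sub, h1, Complex.sub_re, Complex.ofReal_re] at h5
    linarith
  intro a
  have hsa := IsSelfAdjoint.star_mul_self a
  rw [Complex.le_def]
  refine ⟨?_, (key _ hsa).symm⟩
  set x := star a * a
  have hx : 0 ≤ x := star_mul_self_nonneg a
  have := key2 ((‖x‖ + 1)⁻¹ • x) (smul_nonneg (by positivity) hx) (by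
    rw [norm_smul, Real.norm_eq_abs, abs_of_nonneg (by positivity), inv_mul_le_iff₀ (by positivity)]
    linarith)
  rw [map_rsmul, Complex.re_ofReal_mul] at this
  have hp : 0 < (‖x‖ + 1)⁻¹ := by positivity
  exact (mul_nonneg_iff_of_pos_left hp).mp this

/-- For `z` central, the key regularised polar decomposition estimate. -/
lemma exists_central_polar {z : A} (hz : ∀ x, Commute z x) {ε : ℝ} (hε : 0 < ε) :
    ∃ b c : A, 0 ≤ b ∧ (∀ x, Commute b x) ∧ (∀ x, Commute c x) ∧ ‖c‖ ≤ 1 ∧ b ≤ c * z + ε • (1 : A) ∧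
      ∀ (f : A →L[ℂ] ℂ), Pos f → ∀ x, ‖f (x * z)‖ ≤ ‖x‖ * (f b).re := by
  have hzs : ∀ x, Commute (star z) x := fun x => by
    have := (hz (star x)).star_star
    simpa using this
  have hw : 0 ≤ star z * z := star_mul_self_nonneg z
  obtain ⟨a, a', ha, ha', haa', ha'a, ha4, hale, hcom⟩ := exists_reg hw hε
  have hwc : ∀ x, Commute (star z * z) x := fun x => (hzs x).mul_left (hz x)
  have hac : ∀ x, Commute a x := fun x => (hcom x (hwc x)).1
  have hac' : ∀ x, Commute a' x := fun x => (hcom x (hwc x)).2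
  have hw' : star z * z = a * a * (a * a) - (ε ^ 2) • (1 : A) := by rw [ha4]; abel
  have hbin : 0 ≤ a' * a' := by
    have := star_mul_self_nonneg a'
    rwa [ha'.star_eq] at this
  have haa : a * a * (a' * a') = 1 := by
    rw [mul_assoc, ← mul_assoc a a', haa', one_mul, haa']
  have hcz : star z * z * (a' * a') = a * a - (ε ^ 2) • (a' * a') := by
    rw [hw', sub_mul, mul_assoc (a * a), haa, mul_one, smul_mul_assoc, one_mul]
  have hb0 : 0 ≤ a * a := by
    have := star_mul_self_nonneg a
    rwa [ha.star_eq] at this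
  refine ⟨a * a, star z * (a' * a'), hb0, fun x => (hac x).mul_left (hac x),
    fun x => (hzs x).mul_left ((hac' x).mul_left (hac' x)), ?_, ?_, ?_⟩
  · have h1 : star (star z * (a' * a')) * (star z * (a' * a')) =
        1 - (ε ^ 2) • (a' * a' * (a' * a')) := by
      rw [star_mul, star_mul, star_star, ha'.star_eq, mul_assoc, ← mul_assoc z,
        ← (hzs z).eq, hcz, mul_sub, mul_smul_comm, (((hac' (a * a)).mul_left (hac' (a*a)))).eq, haa]
    have h2 : ‖star z * (a' * a')‖ ^ 2 ≤ 1 := by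
      rw [sq, ← CStarRing.norm_star_mul_self]
      refine (CStarAlgebra.norm_le_one_iff_of_nonneg _ (star_mul_self_nonneg _)).mpr ?_
      rw [h1, sub_le_self_iff]
      refine smul_nonneg (sq_nonneg _) ?_
      have := star_mul_self_nonneg (a' * a')
      rwa [star_mul, ha'.star_eq] at this
    nlinarith [norm_nonneg (star z * (a' * a'))]
  · have h1 : star z * (a' * a') * z = a * a - (ε ^ 2) • (a' * a') := by
      rw [mul_assoc, ((hac' z).mul_left (hac' z)).eq, ← mul_assoc, hcz]
    rw [h1]
    have : (ε ^ 2) • (a' * a') ≤ ε • (1 : A) := by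
      rw [sq, mul_smul]
      exact smul_le_smul_of_nonneg_left hale hε.le
    have h2 := sub_nonneg.mpr this
    rw [← sub_nonneg]
    convert h2 using 1
    abel
  · intro f hf x
    have e : x * z = star a * (x * (a' * z)) := by
      rw [ha.star_eq, ← mul_assoc, (hac x).eq, mul_assoc, ← mul_assoc a, haa', one_mul]
    have h1 := hf.cs a (x * (a' * z))
    rw [← e, ha.star_eq] at h1
    have h2 : star (x * (a' * z)) * (x * (a' * z)) ≤ (‖x‖ ^ 2) • (a * a) := by
      have := star_mul_mul_le x (a' * z)
      have e2 : star (a' * z) * (a' * z) = a * a - (ε ^ 2) • (a' * a') := by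
        rw [← hcz, star_mul, ha'.star_eq]
        simp only [mul_assoc]
        rw [(hac' z).eq, ← mul_assoc a' z, (hac' z).eq, mul_assoc]
      rw [star_mul]
      calc star (a' * z) * star x * (x * (a' * z))
          = star (a' * z) * (star x * x) * (a' * z) := by simp only [mul_assoc]
        _ ≤ _ := this
        _ ≤ _ := by
          refine smul_le_smul_of_nonneg_left ?_ (sq_nonneg _)
          rw [e2, sub_le_self_iff]
          exact smul_nonneg (sq_nonneg _) hbin
    have h3 := hf.mono h2
    rw [map_rsmul, Complex.re_ofReal_mul] at h3
    have h4 : 0 ≤ (f (a * a)).re := hf.re_nonneg hb0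
    have h5 : ‖f (x * z)‖ ^ 2 ≤ (‖x‖ * (f (a * a)).re) ^ 2 := by nlinarith
    exact abs_le_of_sq_le_sq' h5 (by positivity) |>.2

lemma Pos.conj {f : A →L[ℂ] ℂ} (hf : Pos f) {g : A →L[ℂ] ℂ} (a : A)
    (hg : ∀ x, g x = f (star a * x * a)) : Pos g := by
  intro x
  rw [hg]
  have : star a * (star x * x) * a = star (x * a) * (x * a) := by
    rw [star_mul]; simp only [mul_assoc]
  rw [this]; exact hf _

lemma central_sqrt {c : A} (hc0 : 0 ≤ c) (hc : ∀ x, Commute c x) :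
    ∃ d : A, IsSelfAdjoint d ∧ (∀ x, Commute d x) ∧ d * d = c := by
  refine ⟨CFC.sqrt c, IsSelfAdjoint.of_nonneg (CFC.sqrt_nonneg c), fun x => ?_,
    CFC.sqrt_mul_sqrt_self c hc0⟩
  rw [CFC.sqrt_eq_cfc]
  exact (hc x).cfc_nnreal _

lemma Pos.norm_central_mul_le {f : A →L[ℂ] ℂ} (hf : Pos f) {c : A} (hc0 : 0 ≤ c)
    (hc : ∀ x, Commute c x) (x : A) : ‖f (c * x)‖ ≤ ‖x‖ * (f c).re := by
  obtain ⟨d, hd, hdc, rfl⟩ := central_sqrt hc0 hc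
  have h1 := hf.cs d (d * x)
  rw [hd.star_eq, ← mul_assoc] at h1
  have h2 : star (d * x) * (d * x) ≤ (‖x‖ ^ 2) • (d * d) := by
    have := star_mul_mul_le x d
    rw [hd.star_eq] at this
    convert this using 1
    rw [star_mul, hd.star_eq, mul_assoc, ← mul_assoc d d x, (hc x).eq, ← mul_assoc,
      ← (hc _).eq, mul_assoc d d, (hdc (_)).eq, mul_assoc d]
  have h3 := hf.mono h2
  rw [map_rsmul, Complex.re_ofReal_mul] at h3
  have h4 : 0 ≤ (f (d * d)).re := hf.re_nonneg hc0
  have h5 : ‖f (d * d * x)‖ ^ 2 ≤ (‖x‖ * (f (d * d)).re) ^ 2 := by nlinarith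
  exact abs_le_of_sq_le_sq' h5 (by positivity) |>.2

end Generic

section VNInst

lemma vn_mem_iff (M : VonNeumannAlgebra H) (x : H →L[ℂ] H) :
    x ∈ M ↔ ∀ y ∈ M.commutant, y * x = x * y := by
  conv_lhs => rw [← M.commutant_commutant]
  exact VonNeumannAlgebra.mem_commutant_iff

lemma vn_isClosed (M : VonNeumannAlgebra H) : IsClosed (M : Set (H →L[ℂ] H)) := by
  have : (M : Set (H →L[ℂ] H)) = ⋂ y ∈ M.commutant, {x | y * x = x * y} := by
    ext x
    simp only [SetLike.mem_coe, Set.mem_iInter, Set.mem_ofPred_eq]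
    exact vn_mem_iff M x
  rw [this]
  exact isClosed_biInter fun y _ => isClosed_eq (by fun_prop) (by fun_prop)

@[reducible] def vnCStar (M : VonNeumannAlgebra H) : CStarAlgebra ↥M where
  complete := by
    have : CompleteSpace ↥(M : Set (H →L[ℂ] H)) := (vn_isClosed M).completeSpace_coe
    exact fun {f} hf => this.complete hf
  norm_mul_self_le x := by
    exact CStarRing.norm_mul_self_le (x : H →L[ℂ] H)
  star_smul c x := Subtype.ext (star_smul c (x : H →L[ℂ] H))

@[reducible] def vnOrder (M : VonNeumannAlgebra H) : PartialOrder ↥M :=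
  PartialOrder.lift (fun x : ↥M => (x : H →L[ℂ] H)) Subtype.val_injective

section
attribute [local instance] vnCStar
attribute [local instance] vnOrder
lemma vnSOR (M : VonNeumannAlgebra H) : StarOrderedRing ↥M := by
  refine StarOrderedRing.of_nonneg_iff' (fun {x y} h z => ?_) (fun x => ⟨fun hx => ?_, ?_⟩)
  · exact add_le_add_right (α := H →L[ℂ] H) h z
  · have hx' : 0 ≤ (x : H →L[ℂ] H) := hx
    have hm : CFC.sqrt (x : H →L[ℂ] H) ∈ M := by
      rw [vn_mem_iff]
      intro y hy
      rw [CFC.sqrt_eq_cfc]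
      have : Commute (x : H →L[ℂ] H) y := ((vn_mem_iff M _).mp x.2 y hy).symm
      exact (this.cfc_nnreal _).symm
    refine ⟨⟨_, hm⟩, Subtype.ext ?_⟩
    have h1 : IsSelfAdjoint (CFC.sqrt (x : H →L[ℂ] H)) :=
      IsSelfAdjoint.of_nonneg (CFC.sqrt_nonneg _)
    change _ = star (CFC.sqrt (x : H →L[ℂ] H)) * CFC.sqrt (x : H →L[ℂ] H)
    rw [h1.star_eq, CFC.sqrt_mul_sqrt_self _ hx']
  · rintro ⟨s, rfl⟩
    exact star_mul_self_nonneg (s : H →L[ℂ] H)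

end

/-- A copy of the carrier of `M` whose only instances are the C*-algebra ones. -/
def Car (M : VonNeumannAlgebra H) : Type u := ↥M

def carCStar (M : VonNeumannAlgebra H) : CStarAlgebra (Car M) := vnCStar M
def carOrder (M : VonNeumannAlgebra H) : PartialOrder (Car M) := vnOrder M
instance (M : VonNeumannAlgebra H) : CStarAlgebra (Car M) := carCStar M
instance (M : VonNeumannAlgebra H) : PartialOrder (Car M) := carOrder M
instance (M : VonNeumannAlgebra H) : StarOrderedRing (Car M) := vnSOR M

/-- the inclusion in the bounded operators -/
def op : Car M →⋆ₐ[ℂ] (H →L[ℂ] H) where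
  toFun x := Subtype.val x
  map_one' := rfl
  map_mul' _ _ := rfl
  map_zero' := rfl
  map_add' _ _ := rfl
  commutes' c := (Algebra.algebraMap_eq_smul_one c).symm
  map_star' _ := rfl

def Car.mk (x : H →L[ℂ] H) (hx : x ∈ M) : Car M := (⟨x, hx⟩ : ↥M)

@[simp] lemma op_mk (x : H →L[ℂ] H) (hx : x ∈ M) : op (Car.mk x hx) = x := rfl

lemma op_mem (x : Car M) : op x ∈ M := Subtype.property x

lemma op_inj {x y : Car M} (h : op x = op y) : x = y := Subtype.ext h

lemma op_norm (x : Car M) : ‖op x‖ = ‖x‖ := rfl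

lemma op_le {x y : Car M} : x ≤ y ↔ op x ≤ op y := Iff.rfl

lemma op_apply_le (x : Car M) (v : H) : ‖op x v‖ ≤ ‖x‖ * ‖v‖ := (op x).le_opNorm v

/-- Normal functionals. -/
def Nml (g : Car M →L[ℂ] ℂ) : Prop :=
  ∃ x y : ℕ → H, Summable (fun n => ‖x n‖ ^ 2) ∧ Summable (fun n => ‖y n‖ ^ 2) ∧
    ∀ a : Car M, HasSum (fun n => ⟪x n, op a (y n)⟫) (g a)

/-- vector functional -/
def vecF (M : VonNeumannAlgebra H) (ξ η : H) : Car M →L[ℂ] ℂ :=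
  LinearMap.mkContinuous
    { toFun := fun a => ⟪ξ, (op a) η⟫
      map_add' := fun a b => by
        rw [map_add, add_apply, inner_add_right]
      map_smul' := fun c a => by
        rw [map_smul, smul_apply, inner_smul_right]; rfl }
    (‖ξ‖ * ‖η‖) (fun a => by
      change ‖⟪ξ, (op a) η⟫‖ ≤ _
      calc _ ≤ ‖ξ‖ * ‖(op a) η‖ := norm_inner_le_norm _ _
        _ ≤ ‖ξ‖ * (‖(op a)‖ * ‖η‖) := by gcongr; exact ContinuousLinearMap.le_opNorm _ _
        _ = ‖ξ‖ * ‖η‖ * ‖a‖ := by rw [op_norm]; ring)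

@[simp] lemma vecF_apply (ξ η : H) (a : Car M) : vecF M ξ η a = ⟪ξ, (op a) η⟫ := rfl

lemma vecF_norm_le (ξ η : H) : ‖vecF M ξ η‖ ≤ ‖ξ‖ * ‖η‖ :=
  LinearMap.mkContinuous_norm_le _ (by positivity) _

/-- Normality w.r.t. an arbitrary countable index -/
lemma isNormal_of_countable {ι : Type*} [Countable ι] {x y : ι → H} {g : Car M →L[ℂ] ℂ}
    (hx : Summable fun n => ‖x n‖ ^ 2) (hy : Summable fun n => ‖y n‖ ^ 2)
    (hg : ∀ a : Car M, HasSum (fun n => ⟪x n, (op a) (y n)⟫) (g a)) :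
    Nml g := by
  obtain ⟨e, he⟩ := exists_injective_nat ι
  have key : ∀ {E : Type u} [NormedAddCommGroup E] (z : ι → E) (n : ℕ), n ∉ Set.range e →
      Function.extend e z 0 n = 0 := by
    intro E _ z n hn
    rw [Function.extend_apply' _ _ _ (fun h => hn h)]; rfl
  refine ⟨Function.extend e x 0, Function.extend e y 0, ?_, ?_, fun a => ?_⟩
  · rw [← Function.Injective.summable_iff he]
    · simpa [Function.comp_def, he.extend_apply] using hx
    · intro n hn; rw [key x n hn]; simp
  · rw [← Function.Injective.summable_iff he]
    · simpa [Function.comp_def, he.extend_apply] using hy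
    · intro n hn; rw [key y n hn]; simp
  · rw [← Function.Injective.hasSum_iff he]
    · simpa [Function.comp_def, he.extend_apply] using hg a
    · intro n hn; rw [key y n hn]; simp

lemma isNormal_vecF (ξ η : H) : Nml (vecF M ξ η) := by
  refine isNormal_of_countable (ι := Unit) (x := fun _ => ξ) (y := fun _ => η) ?_ ?_ ?_
  · exact (hasSum_fintype _).summable
  · exact (hasSum_fintype _).summable
  · intro a; simp

lemma Nml.add {g h : Car M →L[ℂ] ℂ} (hg : Nml g)
    (hh : Nml h) : Nml (g + h) := by
  obtain ⟨x, y, hx, hy, hxy⟩ := hg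
  obtain ⟨x', y', hx', hy', hxy'⟩ := hh
  refine isNormal_of_countable (ι := ℕ ⊕ ℕ) (x := Sum.elim x x') (y := Sum.elim y y') ?_ ?_ ?_
  · exact (HasSum.sum (f := fun n => ‖Sum.elim x x' n‖ ^ 2) hx.hasSum hx'.hasSum).summable
  · exact (HasSum.sum (f := fun n => ‖Sum.elim y y' n‖ ^ 2) hy.hasSum hy'.hasSum).summable
  · intro a
    exact HasSum.sum (f := fun n => ⟪Sum.elim x x' n, (op a) (Sum.elim y y' n)⟫)
      (hxy a) (hxy' a)

lemma Nml.smul {g : Car M →L[ℂ] ℂ} (hg : Nml g) (c : ℂ) :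
    Nml (c • g) := by
  obtain ⟨x, y, hx, hy, hxy⟩ := hg
  refine ⟨x, fun n => c • y n, hx, ?_, ?_⟩
  · simp only [norm_smul, mul_pow]; exact hy.mul_left _
  · intro a
    simp only [map_smul, inner_smul_right]
    exact (hxy a).mul_left c

lemma Nml.zero : Nml (0 : Car M →L[ℂ] ℂ) := by
  have := (isNormal_vecF (M := M) 0 0).smul 0
  rwa [show (0:ℂ) • vecF M 0 0 = 0 by ext; simp] at this

lemma Nml.neg {g : Car M →L[ℂ] ℂ} (hg : Nml g) :
    Nml (-g) := by
  have := hg.smul (-1)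
  rwa [show (-1:ℂ) • g = -g from neg_one_smul ℂ g] at this

lemma Nml.sub {g h : Car M →L[ℂ] ℂ} (hg : Nml g)
    (hh : Nml h) : Nml (g - h) := by
  rw [sub_eq_add_neg]; exact hg.add hh.neg

lemma Nml.sum {ι : Type*} (s : Finset ι) {g : ι → (Car M →L[ℂ] ℂ)}
    (hg : ∀ i ∈ s, Nml (g i)) : Nml (∑ i ∈ s, g i) := by
  classical
  induction s using Finset.induction_on with
  | empty => simpa using Nml.zero
  | insert a s ha ih =>
    rw [Finset.sum_insert ha]
    exact (hg a (Finset.mem_insert_self _ _)).add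
      (ih fun i hi => hg i (Finset.mem_insert_of_mem hi))

/-- `x ↦ g (a x b)` -/
def sand (g : Car M →L[ℂ] ℂ) (a b : Car M) : Car M →L[ℂ] ℂ :=
  g.comp (((ContinuousLinearMap.mul ℂ (Car M)).flip b).comp (ContinuousLinearMap.mul ℂ (Car M) a))

@[simp] lemma sand_apply (g : Car M →L[ℂ] ℂ) (a b x : Car M) : sand g a b x = g (a * x * b) := rfl

lemma Nml.sand {g : Car M →L[ℂ] ℂ} (hg : Nml g) (a b : Car M) :
    Nml (sand g a b) := by
  obtain ⟨x, y, hx, hy, hxy⟩ := hg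
  refine ⟨fun n => ContinuousLinearMap.adjoint (op a) (x n),
    fun n => (op b) (y n), ?_, ?_, ?_⟩
  · refine Summable.of_nonneg_of_le (fun n => by positivity) (fun n => ?_)
      (hx.mul_left (‖ContinuousLinearMap.adjoint (op a)‖ ^ 2))
    rw [← mul_pow]
    gcongr; exact ContinuousLinearMap.le_opNorm _ _
  · refine Summable.of_nonneg_of_le (fun n => by positivity) (fun n => ?_)
      (hy.mul_left (‖(op b)‖ ^ 2))
    rw [← mul_pow]
    gcongr; exact ContinuousLinearMap.le_opNorm _ _
  · intro z
    simp only [ContinuousLinearMap.adjoint_inner_left]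
    have := hxy (a * z * b)
    rw [map_mul, map_mul] at this
    exact this

/-- `x ↦ g (a x)` -/
def lmul (g : Car M →L[ℂ] ℂ) (a : Car M) : Car M →L[ℂ] ℂ := g.comp (ContinuousLinearMap.mul ℂ (Car M) a)

@[simp] lemma lmul_apply (g : Car M →L[ℂ] ℂ) (a x : Car M) : lmul g a x = g (a * x) := rfl

lemma Nml.lmul {g : Car M →L[ℂ] ℂ} (hg : Nml g) (a : Car M) :
    Nml (lmul g a) := by
  have := hg.sand a 1
  have e : VonNeumannAlgebraPaper.sand g a 1 = VonNeumannAlgebraPaper.lmul g a := by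
    ext x; simp
  rwa [e] at this



lemma op_rsmul (r : ℝ) (x : Car M) : op (r • x) = r • op x := by
  rw [← Complex.coe_smul, map_smul, Complex.coe_smul]

end VNInst

set_option linter.all false
section Normal

lemma summable_norm_mul {ι : Type*} {x y : ι → H} (hx : Summable fun n => ‖x n‖ ^ 2)
    (hy : Summable fun n => ‖y n‖ ^ 2) : Summable fun n => ‖x n‖ * ‖y n‖ := by
  refine Summable.of_nonneg_of_le (fun n => by positivity) (fun n => ?_) (hx.add hy)
  nlinarith [sq_nonneg (‖x n‖ - ‖y n‖), sq_nonneg (‖x n‖), sq_nonneg (‖y n‖)]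

lemma summable_vecF {ι : Type*} {x y : ι → H} (hx : Summable fun n => ‖x n‖ ^ 2)
    (hy : Summable fun n => ‖y n‖ ^ 2) : Summable fun n => vecF M (x n) (y n) :=
  Summable.of_norm_bounded (summable_norm_mul hx hy) (fun n => vecF_norm_le _ _)

lemma HasSum.evalF {ι : Type*} {f : ι → (Car M →L[ℂ] ℂ)} {g : Car M →L[ℂ] ℂ} (h : HasSum f g)
    (a : Car M) : HasSum (fun n => f n a) (g a) :=
  h.mapL (ContinuousLinearMap.apply ℂ ℂ a)

lemma exists_of_summable {ι : Type*} [Countable ι] {x y : ι → H}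
    (hx : Summable fun n => ‖x n‖ ^ 2) (hy : Summable fun n => ‖y n‖ ^ 2) :
    ∃ g : Car M →L[ℂ] ℂ, Nml g ∧ ∀ a : Car M, HasSum (fun n => ⟪x n, op a (y n)⟫) (g a) := by
  have h := (summable_vecF (M := M) hx hy).hasSum
  refine ⟨_, isNormal_of_countable hx hy (fun a => HasSum.evalF h a), fun a => HasSum.evalF h a⟩

lemma hasSum_vecF {ι : Type*} {x y : ι → H} {g : Car M →L[ℂ] ℂ}
    (hx : Summable fun n => ‖x n‖ ^ 2) (hy : Summable fun n => ‖y n‖ ^ 2)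
    (hg : ∀ a : Car M, HasSum (fun n => ⟪x n, op a (y n)⟫) (g a)) :
    HasSum (fun n => vecF M (x n) (y n)) g := by
  have h := (summable_vecF (M := M) hx hy).hasSum
  have : ∑' n, vecF M (x n) (y n) = g := by
    ext a
    exact (HasSum.evalF h a).unique (hg a)
  rwa [this] at h

/-- The predual duality: an element of the bidual restricts to an element of `M` on normal
functionals. -/
lemma exists_T (F : (Car M →L[ℂ] ℂ) →L[ℂ] ℂ) :
    ∃ T : Car M, ‖T‖ ≤ ‖F‖ ∧ ∀ g, Nml g → F g = g T := by
  let B : H →L⋆[ℂ] H →L[ℂ] ℂ := LinearMap.mkContinuous₂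
    (LinearMap.mk₂'ₛₗ (starRingEnd ℂ) (RingHom.id ℂ) (fun ξ η => F (vecF M ξ η))
      (fun ξ ξ' η => by
        rw [← map_add]; congr 1; ext a; simp [inner_add_left])
      (fun c ξ η => by
        rw [smul_eq_mul, ← smul_eq_mul, ← map_smul]; congr 1; ext a; simp [inner_smul_left, mul_comm])
      (fun ξ η η' => by
        rw [← map_add]; congr 1; ext a; simp [inner_add_right])
      (fun c ξ η => by
        rw [RingHom.id_apply, ← map_smul]; congr 1; ext a; simp [inner_smul_right]))
    ‖F‖ (fun ξ η => by
      change ‖F (vecF M ξ η)‖ ≤ _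
      refine (F.le_opNorm _).trans ?_
      rw [mul_assoc]
      gcongr
      exact vecF_norm_le _ _)
  let T : H →L[ℂ] H := ContinuousLinearMap.adjoint (InnerProductSpace.continuousLinearMapOfBilin B)
  have hT : ∀ ξ η, ⟪ξ, T η⟫ = F (vecF M ξ η) := fun ξ η => by
    rw [ContinuousLinearMap.adjoint_inner_right]
    exact InnerProductSpace.continuousLinearMapOfBilin_apply B ξ η
  have hTM : T ∈ M := by
    rw [vn_mem_iff]
    intro y hy
    ext η
    refine ext_inner_left ℂ fun ξ => ?_
    change ⟪ξ, y (T η)⟫ = ⟪ξ, T (y η)⟫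
    rw [hT, ← ContinuousLinearMap.adjoint_inner_left, hT]
    congr 1
    ext a
    simp only [vecF_apply]
    rw [ContinuousLinearMap.adjoint_inner_left]
    have := (vn_mem_iff M _).mp (op_mem a) y hy
    exact congrArg (fun z : H →L[ℂ] H => ⟪ξ, z η⟫) this
  refine ⟨Car.mk T hTM, ?_, ?_⟩
  · rw [← op_norm, op_mk]
    refine T.opNorm_le_bound (norm_nonneg F) fun η => ?_
    have h1 : ‖T η‖ * ‖T η‖ ≤ ‖F‖ * ‖η‖ * ‖T η‖ := by
      rw [← inner_self_eq_norm_mul_norm (𝕜 := ℂ), hT]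
      refine (Complex.re_le_norm _).trans ((F.le_opNorm _).trans ?_)
      rw [mul_assoc, mul_comm ‖η‖]
      gcongr
      exact vecF_norm_le _ _
    rcases (norm_nonneg (T η)).eq_or_lt with h0 | hp
    · rw [← h0]; positivity
    · exact le_of_mul_le_mul_right h1 hp
  · rintro g ⟨x, y, hx, hy, hg⟩
    have h1 := (hasSum_vecF hx hy hg).mapL F
    have h2 := hg (Car.mk T hTM)
    simp only [op_mk, hT] at h2
    exact h1.unique h2

/-- Hahn-Banach separation in the predual. -/
lemma mem_closure_of_forall {S : Set (Car M →L[ℂ] ℂ)} (hS : ∀ s ∈ S, Nml s)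
    (hconv : ∀ f ∈ S, ∀ g ∈ S, ∀ t : ℝ, 0 ≤ t → t ≤ 1 →
      (t : ℂ) • f + ((1 - t : ℝ) : ℂ) • g ∈ S)
    {ρ : Car M →L[ℂ] ℂ} (hρ : Nml ρ)
    (h : ∀ T : Car M, ∀ δ : ℝ, 0 < δ → ∃ s ∈ S, (ρ T).re - δ ≤ (s T).re) : ρ ∈ closure S := by
  by_contra hn
  have hc : Convex ℝ S := by
    intro f hf g hg a b ha hb hab
    have := hconv f hf g hg a ha (by linarith)
    rw [show 1 - a = b by linarith] at this
    have e : a • f + b • g = (a : ℂ) • f + (b : ℂ) • g := by ext x; simp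
    rw [e]; exact this
  obtain ⟨F, u, h1, h2⟩ := RCLike.geometric_hahn_banach_closed_point (𝕜 := ℂ) hc.closure
    isClosed_closure hn
  obtain ⟨T, -, hT⟩ := exists_T F
  rw [hT ρ hρ] at h2
  obtain ⟨s, hs, hs2⟩ := h T (((ρ T).re - u) / 2) (by
    have : u < (ρ T).re := h2
    linarith)
  have h3 := h1 s (subset_closure hs)
  rw [hT s (hS s hs)] at h3
  have h4 : u < (ρ T).re := h2
  have h5 : (s T).re < u := h3
  linarith

/-- normal functionals with a representation of size `≤ r` -/
def Rep (r : ℝ) : Set (Car M →L[ℂ] ℂ) := {g | ∃ x y : ℕ → H, (∃ s ≤ r, HasSum (fun n => ‖x n‖ ^ 2) s) ∧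
  (∃ s ≤ r, HasSum (fun n => ‖y n‖ ^ 2) s) ∧
    ∀ a : Car M, HasSum (fun n => ⟪x n, op a (y n)⟫) (g a)}

lemma Rep.nml {r : ℝ} {g : Car M →L[ℂ] ℂ} (hg : g ∈ Rep r) : Nml g := by
  obtain ⟨x, y, ⟨s, -, hs⟩, ⟨t, -, ht⟩, h⟩ := hg
  exact ⟨x, y, hs.summable, ht.summable, h⟩

lemma rep_of_countable {ι : Type*} [Countable ι] {x y : ι → H} {g : Car M →L[ℂ] ℂ} {r s t : ℝ}
    (hx : HasSum (fun n => ‖x n‖ ^ 2) s) (hs : s ≤ r) (hy : HasSum (fun n => ‖y n‖ ^ 2) t)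
    (ht : t ≤ r)
    (hg : ∀ a : Car M, HasSum (fun n => ⟪x n, op a (y n)⟫) (g a)) : g ∈ Rep r := by
  obtain ⟨e, he⟩ := exists_injective_nat ι
  have key : ∀ {E : Type u} [NormedAddCommGroup E] (z : ι → E) (n : ℕ), n ∉ Set.range e →
      Function.extend e z 0 n = 0 := by
    intro E _ z n hn
    rw [Function.extend_apply' _ _ _ (fun h => hn h)]; rfl
  refine ⟨Function.extend e x 0, Function.extend e y 0, ⟨s, hs, ?_⟩, ⟨t, ht, ?_⟩, fun a => ?_⟩
  · rw [← Function.Injective.hasSum_iff he]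
    · simpa [Function.comp_def, he.extend_apply] using hx
    · intro n hn; rw [key x n hn]; simp
  · rw [← Function.Injective.hasSum_iff he]
    · simpa [Function.comp_def, he.extend_apply] using hy
    · intro n hn; rw [key y n hn]; simp
  · rw [← Function.Injective.hasSum_iff he]
    · simpa [Function.comp_def, he.extend_apply] using hg a
    · intro n hn; rw [key y n hn]; simp

lemma vecF_rep {r : ℝ} {ξ η : H} (hξ : ‖ξ‖ ^ 2 ≤ r) (hη : ‖η‖ ^ 2 ≤ r) :
    vecF M ξ η ∈ Rep r := by
  refine rep_of_countable (ι := Unit) (x := fun _ => ξ) (y := fun _ => η) (s := ‖ξ‖ ^ 2)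
    (t := ‖η‖ ^ 2) ?_ hξ ?_ hη ?_
  · simpa using hasSum_fintype (fun _ : Unit => ‖ξ‖ ^ 2)
  · simpa using hasSum_fintype (fun _ : Unit => ‖η‖ ^ 2)
  · intro a; simpa using hasSum_fintype (fun _ : Unit => ⟪ξ, op a η⟫)

lemma rep_convex {r : ℝ} {f g : Car M →L[ℂ] ℂ} (hf : f ∈ Rep r) (hg : g ∈ Rep r) {t : ℝ}
    (h0 : 0 ≤ t) (h1 : t ≤ 1) : (t : ℂ) • f + ((1 - t : ℝ) : ℂ) • g ∈ Rep r := by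
  obtain ⟨x, y, ⟨s, hs, hx⟩, ⟨s', hs', hy⟩, hf⟩ := hf
  obtain ⟨x', y', ⟨p, hp, hx'⟩, ⟨p', hp', hy'⟩, hg⟩ := hg
  have h1' : 0 ≤ 1 - t := by linarith
  have sc : ∀ {u q : ℝ} {z : ℕ → H}, 0 ≤ u → HasSum (fun n => ‖z n‖ ^ 2) q →
      HasSum (fun n => ‖((√u : ℝ) : ℂ) • z n‖ ^ 2) (u * q) := by
    intro u q z hu hz
    have := hz.mul_left u
    have e : (fun n => ‖((√u : ℝ) : ℂ) • z n‖ ^ 2) = fun n => u * ‖z n‖ ^ 2 := by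
     funext n
     rw [norm_smul, mul_pow, Complex.norm_real, Real.norm_eq_abs, sq_abs, Real.sq_sqrt hu]
    rw [e]; exact this
  have sc2 : ∀ {u : ℝ} (hu : 0 ≤ u) (z w : H) (a : Car M),
      ⟪((√u : ℝ) : ℂ) • z, op a (((√u : ℝ) : ℂ) • w)⟫ = u * ⟪z, op a w⟫ := by
    intro u hu z w a
    rw [map_smul, inner_smul_left, inner_smul_right, Complex.conj_ofReal, ← mul_assoc,
      ← Complex.ofReal_mul, Real.mul_self_sqrt hu]
  refine rep_of_countable (ι := ℕ ⊕ ℕ)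
    (x := Sum.elim (fun n => ((√t : ℝ) : ℂ) • x n) (fun n => ((√(1 - t) : ℝ) : ℂ) • x' n))
    (y := Sum.elim (fun n => ((√t : ℝ) : ℂ) • y n) (fun n => ((√(1 - t) : ℝ) : ℂ) • y' n))
    (s := t * s + (1 - t) * p) (t := t * s' + (1 - t) * p') ?_ (by nlinarith) ?_ (by nlinarith) ?_
  · exact HasSum.sum (f := fun n => ‖Sum.elim (fun n => ((√t : ℝ) : ℂ) • x n)
      (fun n => ((√(1 - t) : ℝ) : ℂ) • x' n) n‖ ^ 2) (sc h0 hx) (sc h1' hx')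
  · exact HasSum.sum (f := fun n => ‖Sum.elim (fun n => ((√t : ℝ) : ℂ) • y n)
      (fun n => ((√(1 - t) : ℝ) : ℂ) • y' n) n‖ ^ 2) (sc h0 hy) (sc h1' hy')
  · intro a
    refine HasSum.sum ?_ ?_
    · simp only [Function.comp_def, Sum.elim_inl, sc2 h0]
      exact (hf a).mul_left _
    · simp only [Function.comp_def, Sum.elim_inr, sc2 h1']
      exact (hg a).mul_left _

lemma mem_closure_rep {g : Car M →L[ℂ] ℂ} (hg : Nml g) {r : ℝ} (hr : 0 < r) (hgr : ‖g‖ ≤ r) :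
    g ∈ closure (Rep r) := by
  refine mem_closure_of_forall (fun s hs => Rep.nml hs)
    (fun f hf g hg t h0 h1 => rep_convex hf hg h0 h1) hg fun T δ hδ => ?_
  by_contra hcon
  push Not at hcon
  set u := (g T).re - δ with hu
  have hu0 : 0 ≤ u := by
    have := hcon (vecF M 0 0) (vecF_rep (by simpa using hr.le) (by simpa using hr.le))
    simp at this
    exact this.le
  have hT : ‖T‖ ≤ u / r := by
    rw [← op_norm]
    refine (op T).opNorm_le_bound (by positivity) fun η => ?_
    by_cases h0 : op T η = 0
    · rw [h0, norm_zero]; positivity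
    have hη : η ≠ 0 := by rintro rfl; simp at h0
    have hη' : 0 < ‖η‖ := norm_pos_iff.mpr hη
    have hT' : 0 < ‖op T η‖ := norm_pos_iff.mpr h0
    have hsq : √r ^ 2 = r := Real.sq_sqrt hr.le
    have := hcon (vecF M (((√r / ‖op T η‖ : ℝ) : ℂ) • op T η) (((√r / ‖η‖ : ℝ) : ℂ) • η))
      (vecF_rep (by
        rw [norm_smul, Complex.norm_real, Real.norm_eq_abs, abs_of_nonneg (by positivity),
          div_mul_cancel₀ _ hT'.ne', hsq]) (by
        rw [norm_smul, Complex.norm_real, Real.norm_eq_abs, abs_of_nonneg (by positivity),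
          div_mul_cancel₀ _ hη'.ne', hsq]))
    rw [vecF_apply, map_smul, inner_smul_left, inner_smul_right, Complex.conj_ofReal,
      Complex.re_ofReal_mul, Complex.re_ofReal_mul] at this
    have e : (⟪op T η, op T η⟫).re = ‖op T η‖ ^ 2 := inner_self_eq_norm_sq (𝕜 := ℂ) _
    rw [e] at this
    have e2 : √r / ‖op T η‖ * (√r / ‖η‖ * ‖op T η‖ ^ 2) = r * ‖op T η‖ / ‖η‖ := by
      field_simp
      rw [hsq]
    rw [e2, div_lt_iff₀ hη'] at this
    rw [div_mul_eq_mul_div, le_div_iff₀ hr]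
    linarith
  have h1 : (g T).re ≤ r * ‖T‖ := (Complex.re_le_norm _).trans ((g.le_opNorm T).trans (by gcongr))
  have h2 : r * ‖T‖ ≤ u := by
    calc r * ‖T‖ ≤ r * (u / r) := by gcongr
      _ = u := by field_simp
  linarith

/-- The predual is norm closed. -/
lemma isClosed_nml : IsClosed {g : Car M →L[ℂ] ℂ | Nml g} := by
  refine isClosed_of_closure_subset fun g hg => ?_
  set N : Set (Car M →L[ℂ] ℂ) := {g : Car M →L[ℂ] ℂ | Nml g} with hN
  have step : ∀ (r : ℝ) (g : Car M →L[ℂ] ℂ), 0 < r → g ∈ closure N → ‖g‖ ≤ r →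
      ∃ d : Car M →L[ℂ] ℂ, d ∈ Rep (2 * r) ∧ ‖g - d‖ ≤ r / 4 := by
    intro r g hr hg hgr
    obtain ⟨h, hh, hd⟩ := Metric.mem_closure_iff.mp hg (r / 8) (by positivity)
    rw [dist_eq_norm] at hd
    have hhr : ‖h‖ ≤ 2 * r := by
      have := norm_sub_norm_le h g
      rw [norm_sub_rev] at this
      linarith
    obtain ⟨d, hd1, hd2⟩ := Metric.mem_closure_iff.mp (mem_closure_rep hh (by positivity) hhr)
      (r / 8) (by positivity)
    rw [dist_eq_norm] at hd2
    refine ⟨d, hd1, ?_⟩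
    have := norm_add_le (g - h) (h - d)
    rw [sub_add_sub_cancel] at this
    linarith
  choose! D hD1 hD2 using step
  set r : ℝ := ‖g‖ + 1 with hr
  have hr0 : 0 < r := by positivity
  let G : ℕ → (Car M →L[ℂ] ℂ) := fun n => Nat.rec g (fun k G => G - D (r / 4 ^ k) G) n
  have hG0 : G 0 = g := rfl
  have hGs : ∀ k, G (k + 1) = G k - D (r / 4 ^ k) (G k) := fun k => rfl
  have hG : ∀ k, G k ∈ closure N ∧ ‖G k‖ ≤ r / 4 ^ k := by
    intro k
    induction k with
    | zero => exact ⟨hg, by rw [hG0]; simp [hr]⟩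
    | succ k ih =>
      refine ⟨?_, ?_⟩
      · rw [hGs]
        have hd : Nml (D (r / 4 ^ k) (G k)) := Rep.nml (hD1 _ _ (by positivity) ih.1 ih.2)
        have : Set.MapsTo (fun x => x - D (r / 4 ^ k) (G k)) N N := fun x hx => Nml.sub hx hd
        exact this.closure (by fun_prop) ih.1
      · rw [hGs]
        refine (hD2 _ _ (by positivity) ih.1 ih.2).trans (le_of_eq ?_)
        rw [pow_succ]; field_simp
  set d : ℕ → (Car M →L[ℂ] ℂ) := fun k => D (r / 4 ^ k) (G k) with hd
  have hdrep : ∀ k, d k ∈ Rep (2 * (r / 4 ^ k)) := fun k => hD1 _ _ (by positivity) (hG k).1 (hG k).2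
  choose x y hx hy hxy using hdrep
  choose s hs hxs using hx
  choose t ht hyt using hy
  have geo : Summable fun k : ℕ => 2 * (r / 4 ^ k) := by
    have := (summable_geometric_of_lt_one (r := (1/4 : ℝ)) (by norm_num) (by norm_num)).mul_left
      (2 * r)
    refine this.congr fun k => ?_
    rw [one_div, inv_pow]; ring
  have hX : Summable fun p : ℕ × ℕ => ‖x p.1 p.2‖ ^ 2 := by
    rw [summable_prod_of_nonneg (fun _ => by positivity)]
    refine ⟨fun k => (hxs k).summable, Summable.of_nonneg_of_le (fun k => tsum_nonneg fun _ => by positivity) (fun k => ?_) geo⟩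
    rw [(hxs k).tsum_eq]; exact hs k
  have hY : Summable fun p : ℕ × ℕ => ‖y p.1 p.2‖ ^ 2 := by
    rw [summable_prod_of_nonneg (fun _ => by positivity)]
    refine ⟨fun k => (hyt k).summable, Summable.of_nonneg_of_le (fun k => tsum_nonneg fun _ => by positivity) (fun k => ?_) geo⟩
    rw [(hyt k).tsum_eq]; exact ht k
  obtain ⟨g', hg', hsum⟩ := exists_of_summable (M := M) hX hY
  have : g' = g := by
    ext a
    have h1 : HasSum (fun k => d k a) (g' a) :=
      (hsum a).prod_fiberwise (fun k => hxy k a)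
    have h2 : Filter.Tendsto (fun n => ∑ k ∈ Finset.range n, d k a) Filter.atTop (nhds (g a)) := by
      have e : ∀ n, ∑ k ∈ Finset.range n, d k a = g a - G n a := by
        intro n
        induction n with
        | zero => simp [hG0]
        | succ n ih => rw [Finset.sum_range_succ, ih, hGs]; simp [hd]; ring
      simp only [e]
      have h3 : Filter.Tendsto (fun n => G n a) Filter.atTop (nhds 0) := by
        refine squeeze_zero_norm (a := fun n => r / 4 ^ n * ‖a‖) (fun n => ?_) ?_
        · exact ((G n).le_opNorm a).trans (by gcongr; exact (hG n).2)
        · have := (tendsto_pow_atTop_nhds_zero_of_lt_one (r := (1/4 : ℝ)) (by norm_num)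
            (by norm_num)).mul_const (r * ‖a‖)
          rw [zero_mul] at this
          refine this.congr fun n => ?_
          rw [one_div, inv_pow]; ring
      simpa using h3.const_sub (g a)
    exact tendsto_nhds_unique h1.tendsto_sum_nat h2
  rw [← this]; exact hg'

lemma pos_of_hasSum {ι : Type*} {x : ι → H} {g : Car M →L[ℂ] ℂ}
    (hg : ∀ a : Car M, HasSum (fun n => ⟪x n, op a (x n)⟫) (g a)) : Pos g := by
  intro a
  have h := hg (star a * a)
  refine h.nonneg fun n => ?_
  rw [map_mul, map_star]
  change 0 ≤ ⟪x n, ContinuousLinearMap.adjoint (op a) (op a (x n))⟫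
  rw [ContinuousLinearMap.adjoint_inner_right, inner_self_eq_norm_sq_to_K]
  have h2 : (0 : ℝ) ≤ ‖op a (x n)‖ ^ 2 := sq_nonneg _
  have h3 : ((0 : ℝ) : ℂ) ≤ ((‖op a (x n)‖ ^ 2 : ℝ) : ℂ) := Complex.real_le_real.mpr h2
  simpa using h3

lemma funsum_apply {ι : Type*} (s : Finset ι) (G : ι → (Car M →L[ℂ] ℂ)) (a : Car M) :
    (∑ k ∈ s, G k) a = ∑ k ∈ s, G k a := by
  classical
  induction s using Finset.induction_on with
  | empty => simp
  | insert k s hk ih => rw [Finset.sum_insert hk, Finset.sum_insert hk, ← ih]; rfl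

/-- Polarisation of normal functionals. -/
lemma Nml.polar {g : Car M →L[ℂ] ℂ} (hg : Nml g) :
    ∃ (G : Fin 4 → (Car M →L[ℂ] ℂ)) (c : Fin 4 → ℂ), (∀ k, Pos (G k) ∧ Nml (G k)) ∧
      g = ∑ k, c k • G k := by
  obtain ⟨x, y, hx, hy, hxy⟩ := hg
  have hz : ∀ w : ℂ, ‖w‖ = 1 → Summable fun n => ‖x n + w • y n‖ ^ 2 := by
    intro w hw
    refine Summable.of_nonneg_of_le (fun n => by positivity) (fun n => ?_)
      ((hx.mul_left 2).add (hy.mul_left 2))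
    have h1 : ‖x n + w • y n‖ ≤ ‖x n‖ + ‖y n‖ := by
      refine (norm_add_le _ _).trans ?_
      rw [norm_smul, hw, one_mul]
    have := norm_nonneg (x n + w • y n)
    nlinarith [sq_nonneg (‖x n‖ - ‖y n‖)]
  have hI : ∀ k : Fin 4, ‖Complex.I ^ (k : ℕ)‖ = 1 := fun k => by simp
  choose G hGn hG using fun k : Fin 4 => exists_of_summable (M := M) (hz _ (hI k)) (hz _ (hI k))
  refine ⟨G, fun k => (-Complex.I) ^ (k : ℕ) / 4, fun k => ⟨pos_of_hasSum (hG k), hGn k⟩, ?_⟩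
  ext a
  refine (hxy a).unique ?_
  have := hasSum_sum (s := Finset.univ) (fun k (_ : k ∈ Finset.univ) =>
    (hG k a).mul_left ((-Complex.I) ^ (k : ℕ) / 4))
  have e1 : (fun n => ⟪x n, op a (y n)⟫) = fun n => ∑ i : Fin 4, (-Complex.I) ^ (i : ℕ) / 4 *
      ⟪x n + Complex.I ^ (i : ℕ) • y n, op a (x n + Complex.I ^ (i : ℕ) • y n)⟫ := by
    funext n
    simp only [Fin.sum_univ_four, map_add, map_smul, inner_add_left, inner_add_right,
      inner_smul_left, inner_smul_right]
    simp [pow_succ]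
    ring_nf
    try simp
    try ring
  have e2 : (∑ k : Fin 4, ((-Complex.I) ^ (k : ℕ) / 4) • G k) a =
      ∑ i : Fin 4, (-Complex.I) ^ (i : ℕ) / 4 * G i a := by
    rw [funsum_apply]; rfl
  rw [e1, e2]; exact this

end Normal

set_option linter.all false
section Elementary

/-- central elements -/
def Cen (z : Car M) : Prop := ∀ x : Car M, Commute z x

lemma Cen.add {z w : Car M} (hz : Cen z) (hw : Cen w) : Cen (z + w) := fun x => (hz x).add_left (hw x)
lemma Cen.sub {z w : Car M} (hz : Cen z) (hw : Cen w) : Cen (z - w) := fun x => (hz x).sub_left (hw x)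
lemma Cen.mul {z w : Car M} (hz : Cen z) (hw : Cen w) : Cen (z * w) := fun x => (hz x).mul_left (hw x)
lemma Cen.smul {z : Car M} (hz : Cen z) (c : ℂ) : Cen (c • z) := fun x => (hz x).smul_left c
lemma Cen.rsmul {z : Car M} (hz : Cen z) (c : ℝ) : Cen (c • z) := fun x => (hz x).smul_left c
lemma Cen.one : Cen (1 : Car M) := fun x => Commute.one_left x
lemma Cen.zero : Cen (0 : Car M) := fun x => Commute.zero_left x
lemma Cen.star {z : Car M} (hz : Cen z) : Cen (star z) := fun x => by
  have := (hz (Star.star x)).star_star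
  simpa using this

/-- elementary ucp maps -/
def IsE (φ : Car M →L[ℂ] Car M) : Prop :=
  ∃ (n : ℕ) (a : Fin n → Car M), (∑ i, star (a i) * a i) = 1 ∧
    ∀ x : Car M, φ x = ∑ i, star (a i) * x * a i

/-- `x ↦ b* x b` -/
def cj (b : Car M) : Car M →L[ℂ] Car M :=
  (ContinuousLinearMap.mul ℂ (Car M) (star b)).comp ((ContinuousLinearMap.mul ℂ (Car M)).flip b)

lemma cj_apply (b x : Car M) : cj b x = star b * x * b := by
  change star b * (x * b) = _
  rw [mul_assoc]

lemma mapsum_apply {ι : Type*} (s : Finset ι) (G : ι → (Car M →L[ℂ] Car M)) (a : Car M) :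
    (∑ k ∈ s, G k) a = ∑ k ∈ s, G k a := by
  classical
  induction s using Finset.induction_on with
  | empty => simp
  | insert k s hk ih => rw [Finset.sum_insert hk, Finset.sum_insert hk, ← ih]; rfl

lemma isE_of_fintype {ι : Type*} [Fintype ι] {a : ι → Car M} {φ : Car M →L[ℂ] Car M}
    (h1 : (∑ i, star (a i) * a i) = 1) (h : ∀ x : Car M, φ x = ∑ i, star (a i) * x * a i) :
    IsE φ := by
  classical
  let e := Fintype.equivFin ι
  refine ⟨Fintype.card ι, fun i => a (e.symm i), ?_, fun x => ?_⟩
  · rw [← h1]; exact e.symm.sum_comp (fun i => star (a i) * a i)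
  · rw [h]; exact (e.symm.sum_comp (fun i => star (a i) * x * a i)).symm

lemma IsE.comb {ι : Type*} [Fintype ι] {φ : ι → (Car M →L[ℂ] Car M)} (hφ : ∀ i, IsE (φ i))
    {b : ι → Car M} (hb : (∑ i, star (b i) * b i) = 1) :
    ∃ ψ : Car M →L[ℂ] Car M, IsE ψ ∧ ∀ x, ψ x = ∑ i, star (b i) * φ i x * b i := by
  choose n a ha1 ha using hφ
  refine ⟨∑ i, (cj (b i)).comp (φ i), isE_of_fintype (ι := Σ i, Fin (n i))
    (a := fun p => a p.1 p.2 * b p.1) ?_ fun x => ?_, fun x => ?_⟩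
  · rw [Fintype.sum_sigma, ← hb]
    refine Finset.sum_congr rfl fun i _ => ?_
    have : ∀ j, star (a i j * b i) * (a i j * b i) = star (b i) * (star (a i j) * a i j) * b i := by
      intro j; rw [star_mul]; simp only [mul_assoc]
    simp only [this]
    rw [← Finset.sum_mul, ← Finset.mul_sum, ha1, mul_one]
  · rw [Fintype.sum_sigma, mapsum_apply]
    refine Finset.sum_congr rfl fun i _ => ?_
    have : ∀ j, star (a i j * b i) * x * (a i j * b i) =
        star (b i) * (star (a i j) * x * a i j) * b i := by
      intro j; rw [star_mul]; simp only [mul_assoc]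
    simp only [this]
    rw [← Finset.sum_mul, ← Finset.mul_sum, ← ha, ContinuousLinearMap.comp_apply, cj_apply]
  · rw [mapsum_apply]
    refine Finset.sum_congr rfl fun i _ => ?_
    rw [ContinuousLinearMap.comp_apply, cj_apply]

lemma IsE.comb2 {φ₁ φ₂ : Car M →L[ℂ] Car M} (h₁ : IsE φ₁) (h₂ : IsE φ₂) {b₁ b₂ : Car M}
    (hb : star b₁ * b₁ + star b₂ * b₂ = 1) :
    ∃ ψ : Car M →L[ℂ] Car M, IsE ψ ∧ ∀ x, ψ x = star b₁ * φ₁ x * b₁ + star b₂ * φ₂ x * b₂ := by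
  obtain ⟨ψ, h, h'⟩ := IsE.comb (ι := Fin 2) (φ := ![φ₁, φ₂]) (b := ![b₁, b₂])
    (fun i => by fin_cases i <;> assumption) (by simpa using hb)
  exact ⟨ψ, h, fun x => by rw [h']; simp⟩

lemma IsE.id : IsE (ContinuousLinearMap.id ℂ (Car M)) :=
  ⟨1, fun _ => 1, by simp, fun x => by simp⟩

lemma IsE.comp {φ₁ φ₂ : Car M →L[ℂ] Car M} (h₁ : IsE φ₁) (h₂ : IsE φ₂) : IsE (φ₁.comp φ₂) := by
  obtain ⟨n, a, ha1, ha⟩ := h₁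
  obtain ⟨ψ, h, h'⟩ := IsE.comb (φ := fun _ : Fin n => φ₂) (fun _ => h₂) ha1
  have : φ₁.comp φ₂ = ψ := by ext1 x; rw [h']; exact ha _
  rw [this]; exact h

lemma IsE.cut {φ₁ φ₂ : Car M →L[ℂ] Car M} (h₁ : IsE φ₁) (h₂ : IsE φ₂) {e : Car M} (he : Cen e)
    (hs : IsSelfAdjoint e) (hp : e * e = e) :
    ∃ ψ : Car M →L[ℂ] Car M, IsE ψ ∧ ∀ x, ψ x = e * φ₁ x + (1 - e) * φ₂ x := by
  have hp' : (1 - e) * (1 - e) = 1 - e := by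
    rw [mul_sub, mul_one, sub_mul, one_mul, hp]; abel
  have hs' : star (1 - e) = 1 - e := by rw [star_sub, star_one, hs.star_eq]
  obtain ⟨ψ, h, h'⟩ := IsE.comb2 h₁ h₂ (b₁ := e) (b₂ := 1 - e)
    (by rw [hs.star_eq, hp, hs', hp']; abel)
  refine ⟨ψ, h, fun x => ?_⟩
  have hc : Cen (1 - e) := Cen.one.sub he
  rw [h', hs.star_eq, hs', (he _).eq, mul_assoc, hp, (hc _).eq, mul_assoc, hp']

lemma IsE.convex {φ₁ φ₂ : Car M →L[ℂ] Car M} (h₁ : IsE φ₁) (h₂ : IsE φ₂) {t : ℝ} (h0 : 0 ≤ t)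
    (h1 : t ≤ 1) : ∃ ψ : Car M →L[ℂ] Car M, IsE ψ ∧
      ∀ x, ψ x = (t : ℂ) • φ₁ x + ((1 - t : ℝ) : ℂ) • φ₂ x := by
  have h1' : 0 ≤ 1 - t := by linarith
  have key : ∀ u : ℝ, 0 ≤ u → ∀ x : Car M, star (((√u : ℝ) : ℂ) • (1 : Car M)) * x *
      (((√u : ℝ) : ℂ) • (1 : Car M)) = (u : ℂ) • x := by
    intro u hu x
    rw [star_smul, star_one, smul_mul_assoc, one_mul, mul_smul_comm, mul_one, smul_smul]
    congr 1
    change _ * conj _ = _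
    rw [Complex.conj_ofReal, ← Complex.ofReal_mul, Real.mul_self_sqrt hu]
  obtain ⟨ψ, h, h'⟩ := IsE.comb2 h₁ h₂ (b₁ := ((√t : ℝ) : ℂ) • (1 : Car M))
    (b₂ := ((√(1 - t) : ℝ) : ℂ) • (1 : Car M)) (by
      have e1 := key t h0 1
      have e2 := key (1 - t) h1' 1
      rw [mul_one] at e1 e2
      rw [e1, e2, ← add_smul]; simp)
  exact ⟨ψ, h, fun x => by rw [h', key t h0, key _ h1']⟩

lemma IsE.map_one {φ : Car M →L[ℂ] Car M} (h : IsE φ) : φ 1 = 1 := by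
  obtain ⟨n, a, ha1, ha⟩ := h
  rw [ha]; simpa using ha1

lemma IsE.central {φ : Car M →L[ℂ] Car M} (h : IsE φ) {z : Car M} (hz : Cen z) (x : Car M) :
    φ (z * x) = z * φ x := by
  obtain ⟨n, a, ha1, ha⟩ := h
  rw [ha, ha, Finset.mul_sum]
  refine Finset.sum_congr rfl fun i _ => ?_
  rw [← mul_assoc, ← (hz (star (a i))).eq]; simp only [mul_assoc]

lemma IsE.map_central {φ : Car M →L[ℂ] Car M} (h : IsE φ) {z : Car M} (hz : Cen z) :
    φ z = z := by
  have := h.central hz 1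
  rwa [mul_one, h.map_one, mul_one] at this

lemma IsE.nonneg {φ : Car M →L[ℂ] Car M} (h : IsE φ) {x : Car M} (hx : 0 ≤ x) : 0 ≤ φ x := by
  obtain ⟨n, a, ha1, ha⟩ := h
  rw [ha]
  exact Finset.sum_nonneg fun i _ => star_left_conjugate_nonneg hx _

lemma IsE.map_star {φ : Car M →L[ℂ] Car M} (h : IsE φ) (x : Car M) : φ (star x) = star (φ x) := by
  obtain ⟨n, a, ha1, ha⟩ := h
  rw [ha, ha, star_sum]
  refine Finset.sum_congr rfl fun i _ => ?_
  rw [star_mul, star_mul, star_star, mul_assoc]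

lemma IsE.nml {φ : Car M →L[ℂ] Car M} (h : IsE φ) {g : Car M →L[ℂ] ℂ} (hg : Nml g) :
    Nml (g.comp φ) := by
  obtain ⟨n, a, ha1, ha⟩ := h
  have : g.comp φ = ∑ i, sand g (star (a i)) (a i) := by
    ext x
    rw [funsum_apply, ContinuousLinearMap.comp_apply, ha, map_sum]
    rfl
  rw [this]
  exact Nml.sum _ fun i _ => hg.sand _ _

lemma IsE.pos {φ : Car M →L[ℂ] Car M} (h : IsE φ) {g : Car M →L[ℂ] ℂ} (hg : Pos g) :
    Pos (g.comp φ) := fun a => hg.nonneg (h.nonneg (star_mul_self_nonneg a))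

lemma norm_le_of_inner {T : H →L[ℂ] H} {C : ℝ} (hC : 0 ≤ C)
    (h : ∀ ξ η, ‖⟪ξ, T η⟫‖ ≤ C * ‖ξ‖ * ‖η‖) : ‖T‖ ≤ C := by
  refine T.opNorm_le_bound hC fun η => ?_
  have h1 := h (T η) η
  rw [norm_inner_symm, inner_self_eq_norm_sq_to_K] at h1
  have h2 : ‖T η‖ * ‖T η‖ ≤ C * ‖η‖ * ‖T η‖ := by
    have : ‖(((‖T η‖ : ℝ) : ℂ)) ^ 2‖ = ‖T η‖ * ‖T η‖ := by
      rw [norm_pow, Complex.norm_real, norm_norm, sq]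
    calc ‖T η‖ * ‖T η‖ = ‖(((‖T η‖ : ℝ) : ℂ)) ^ 2‖ := this.symm
      _ ≤ C * ‖T η‖ * ‖η‖ := h1
      _ = _ := by ring
  rcases (norm_nonneg (T η)).eq_or_lt with h0 | hp
  · rw [← h0]; positivity
  · exact le_of_mul_le_mul_right h2 hp

lemma sum_inner_star (n : ℕ) (a : Fin n → Car M) (ξ η : H) (x : Car M) :
    ⟪ξ, op (∑ i, star (a i) * x * a i) η⟫ = ∑ i, ⟪op (a i) ξ, op x (op (a i) η)⟫ := by
  rw [map_sum, ContinuousLinearMap.sum_apply, inner_sum]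
  refine Finset.sum_congr rfl fun i _ => ?_
  rw [map_mul, map_mul, map_star]
  exact ContinuousLinearMap.adjoint_inner_right _ _ _

lemma sum_norm_sq {n : ℕ} {a : Fin n → Car M} (h : (∑ i, star (a i) * a i) = 1) (ξ : H) :
    ∑ i, ‖op (a i) ξ‖ ^ 2 = ‖ξ‖ ^ 2 := by
  have h1 := sum_inner_star n a ξ ξ 1
  simp only [mul_one] at h1
  rw [h] at h1
  have h2 := congrArg Complex.re h1
  rw [Complex.re_sum] at h2
  simp only [_root_.map_one] at h2
  have e : ∀ v : H, (⟪v, (1 : H →L[ℂ] H) v⟫).re = ‖v‖ ^ 2 := fun v => inner_self_eq_norm_sq (𝕜 := ℂ) v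
  simp only [e] at h2
  exact h2.symm

lemma IsE.norm_le {φ : Car M →L[ℂ] Car M} (h : IsE φ) (x : Car M) : ‖φ x‖ ≤ ‖x‖ := by
  obtain ⟨n, a, ha1, ha⟩ := h
  rw [← op_norm]
  refine norm_le_of_inner (norm_nonneg _) fun ξ η => ?_
  rw [ha, sum_inner_star]
  calc ‖∑ i, ⟪op (a i) ξ, op x (op (a i) η)⟫‖ ≤ ∑ i, ‖⟪op (a i) ξ, op x (op (a i) η)⟫‖ := norm_sum_le _ _
    _ ≤ ∑ i, ‖x‖ * (‖op (a i) ξ‖ * ‖op (a i) η‖) := by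
        refine Finset.sum_le_sum fun i _ => (norm_inner_le_norm _ _).trans ?_
        calc _ ≤ ‖op (a i) ξ‖ * (‖x‖ * ‖op (a i) η‖) := by gcongr; exact op_apply_le _ _
          _ = _ := by ring
    _ = ‖x‖ * ∑ i, ‖op (a i) ξ‖ * ‖op (a i) η‖ := by rw [Finset.mul_sum]
    _ ≤ ‖x‖ * (‖ξ‖ * ‖η‖) := by
        gcongr
        refine abs_le_of_sq_le_sq' ?_ (by positivity) |>.2
        refine (Finset.sum_mul_sq_le_sq_mul_sq _ _ _).trans ?_
        rw [sum_norm_sq ha1, sum_norm_sq ha1, mul_pow]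
    _ = _ := by ring

lemma IsE.comp_norm_le {φ : Car M →L[ℂ] Car M} (h : IsE φ) (g : Car M →L[ℂ] ℂ) :
    ‖g.comp φ‖ ≤ ‖g‖ :=
  ContinuousLinearMap.opNorm_le_bound _ (norm_nonneg _) fun x =>
    (g.le_opNorm _).trans (by gcongr; exact h.norm_le x)

lemma IsE.mono {φ : Car M →L[ℂ] Car M} (h : IsE φ) {x y : Car M} (hx : x ≤ y) : φ x ≤ φ y := by
  have := h.nonneg (sub_nonneg.mpr hx)
  rwa [map_sub, sub_nonneg] at this

/-- Hahn-Banach for `ω ∘ E`. -/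
lemma mem_closure_mix {ω ρ : Car M →L[ℂ] ℂ} (hω : Nml ω) (hρ : Nml ρ)
    (h : ∀ T : Car M, ∀ δ : ℝ, 0 < δ → ∃ φ, IsE φ ∧ (ρ T).re - δ ≤ (ω (φ T)).re) :
    ∀ ε : ℝ, 0 < ε → ∃ φ, IsE φ ∧ ‖ρ - ω.comp φ‖ < ε := by
  have : ρ ∈ closure {σ : Car M →L[ℂ] ℂ | ∃ φ, IsE φ ∧ σ = ω.comp φ} := by
    refine mem_closure_of_forall ?_ ?_ hρ ?_
    · rintro s ⟨φ, hφ, rfl⟩; exact hφ.nml hω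
    · rintro f ⟨φ, hφ, rfl⟩ g ⟨φ', hφ', rfl⟩ t h0 h1
      obtain ⟨ψ, hψ, hx⟩ := hφ.convex hφ' h0 h1
      refine ⟨ψ, hψ, ?_⟩
      ext x
      change _ = ω (ψ x)
      rw [hx, map_add, map_smul, map_smul]; rfl
    · intro T δ hδ
      obtain ⟨φ, hφ, hh⟩ := h T δ hδ
      exact ⟨_, ⟨φ, hφ, rfl⟩, hh⟩
  intro ε hε
  obtain ⟨_, ⟨φ, hφ, rfl⟩, hd⟩ := Metric.mem_closure_iff.mp this ε hε
  exact ⟨φ, hφ, by rwa [dist_eq_norm] at hd⟩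

/-- Hahn-Banach for `ω ∘ E`, hermitian version. -/
lemma mem_closure_mix' {ω ρ : Car M →L[ℂ] ℂ} (hω : Nml ω) (hρ : Nml ρ)
    (hωh : ∀ a, ω (star a) = conj (ω a)) (hρh : ∀ a, ρ (star a) = conj (ρ a))
    (h : ∀ T : Car M, IsSelfAdjoint T → ∀ δ : ℝ, 0 < δ →
      ∃ φ, IsE φ ∧ (ρ T).re - δ ≤ (ω (φ T)).re) :
    ∀ ε : ℝ, 0 < ε → ∃ φ, IsE φ ∧ ‖ρ - ω.comp φ‖ < ε := by
  refine mem_closure_mix hω hρ fun T δ hδ => ?_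
  have hs : IsSelfAdjoint (((1 / 2 : ℝ)) • (T + star T)) :=
    (IsSelfAdjoint.all (1 / 2 : ℝ)).smul (IsSelfAdjoint.add_star_self T)
  have key : ∀ g : Car M →L[ℂ] ℂ, (∀ a, g (star a) = conj (g a)) →
      (g (((1 / 2 : ℝ)) • (T + star T))).re = (g T).re := by
    intro g hg
    rw [map_rsmul, map_add, hg, Complex.re_ofReal_mul, Complex.add_re, Complex.conj_re]; ring
  obtain ⟨φ, hφ, hh⟩ := h _ hs δ hδ
  refine ⟨φ, hφ, ?_⟩
  rw [key ρ hρh] at hh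
  have := key (ω.comp φ) (fun a => by
    rw [ContinuousLinearMap.comp_apply, hφ.map_star, hωh]; rfl)
  rw [ContinuousLinearMap.comp_apply] at this
  rw [this] at hh
  exact hh

end Elementary

section Center

/-- the center as a von Neumann algebra -/
def Zvn (M : VonNeumannAlgebra H) : VonNeumannAlgebra H where
  toStarSubalgebra := StarSubalgebra.centralizer ℂ ((M : Set (H →L[ℂ] H)) ∪ M.commutant)
  centralizer_centralizer' := by
    change Set.centralizer (Set.centralizer (Set.centralizer _)) = Set.centralizer _
    exact Set.centralizer_centralizer_centralizer _

lemma mem_Zvn {x : H →L[ℂ] H} : x ∈ Zvn M ↔ x ∈ M ∧ x ∈ M.commutant := by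
  have h0 : x ∈ Zvn M ↔ x ∈ StarSubalgebra.centralizer ℂ ((M : Set (H →L[ℂ] H)) ∪ M.commutant) :=
    Iff.rfl
  rw [h0, StarSubalgebra.mem_centralizer_iff, vn_mem_iff M x, VonNeumannAlgebra.mem_commutant_iff]
  constructor
  · intro h
    exact ⟨fun y hy => (h y (Or.inr hy)).1, fun y hy => (h y (Or.inl hy)).1⟩
  · rintro ⟨h1, h2⟩ g (hg | hg)
    · exact ⟨h2 g hg, h2 _ (star_mem (s := M) hg)⟩
    · exact ⟨h1 g hg, h1 _ (star_mem (s := M.commutant) hg)⟩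

/-- inclusion of the center -/
def inc : Car (Zvn M) →L[ℂ] Car M :=
  LinearMap.mkContinuous
    { toFun := fun z => Car.mk (op z) (mem_Zvn.mp (op_mem z)).1
      map_add' := fun a b => rfl
      map_smul' := fun c a => rfl } 1 (fun z => by rw [one_mul]; exact le_rfl)

lemma op_inc (z : Car (Zvn M)) : op (inc z) = op z := rfl
lemma inc_mul (z w : Car (Zvn M)) : inc (z * w) = inc z * inc w := rfl
lemma inc_one : inc (1 : Car (Zvn M)) = 1 := rfl
lemma inc_star (z : Car (Zvn M)) : inc (star z) = star (inc z) := rfl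
lemma inc_norm (z : Car (Zvn M)) : ‖inc z‖ = ‖z‖ := rfl

lemma inc_cen (z : Car (Zvn M)) : Cen (inc z) := fun x => by
  apply op_inj
  rw [map_mul, map_mul, op_inc]
  exact ((VonNeumannAlgebra.mem_commutant_iff.mp (mem_Zvn.mp (op_mem z)).2) _ (op_mem x)).symm

lemma exists_inc {z : Car M} (hz : Cen z) : ∃ z' : Car (Zvn M), inc z' = z := by
  refine ⟨Car.mk (op z) (mem_Zvn.mpr ⟨op_mem z, ?_⟩), rfl⟩
  rw [VonNeumannAlgebra.mem_commutant_iff]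
  intro g hg
  have := (hz (Car.mk g hg)).eq
  have h2 := congrArg op this
  rw [map_mul, map_mul] at h2
  exact h2.symm

lemma Nml.inc {g : Car M →L[ℂ] ℂ} (hg : Nml g) : Nml (g.comp inc) := by
  obtain ⟨x, y, hx, hy, h⟩ := hg
  exact ⟨x, y, hx, hy, fun a => h (VonNeumannAlgebraPaper.inc a)⟩

end Center

set_option linter.all false
section Carrier

lemma norm_le_one_of {f : Car M} (h0 : 0 ≤ f) (h1 : f ≤ 1) : ‖f‖ ≤ 1 :=
  (CStarAlgebra.norm_le_one_iff_of_nonneg f h0).mpr h1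

/-- the regularised inverse -/
lemma reg_step {ι : Type*} (Y : Finset ι) (y : ι → Car M) {ε : ℝ} (hε : 0 < ε) :
    ∃ t : Car M, IsSelfAdjoint t ∧
      0 ≤ 1 - ∑ i ∈ Y, star (y i * t) * (y i * t) ∧
      ‖1 - ∑ i ∈ Y, star (y i * t) * (y i * t)‖ ≤ 1 ∧
      ∀ i ∈ Y, ‖(1 - ∑ i ∈ Y, star (y i * t) * (y i * t)) * star (y i)‖ ≤ ε := by
  set s : Car M := ∑ i ∈ Y, star (y i) * y i with hs
  have hs0 : 0 ≤ s := Finset.sum_nonneg fun i _ => star_mul_self_nonneg _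
  obtain ⟨a, a', ha, ha', haa', ha'a, ha4, hale, -⟩ := exists_reg hs0 hε
  set t : Car M := a' * a' with ht
  have hts : IsSelfAdjoint t := by
    rw [IsSelfAdjoint, ht, star_mul, ha'.star_eq]
  have ht0 : 0 ≤ t := by
    have := star_mul_self_nonneg a'
    rwa [ha'.star_eq] at this
  have hf : ∑ i ∈ Y, star (y i * t) * (y i * t) = t * s * t := by
    rw [hs, Finset.mul_sum, Finset.sum_mul]
    refine Finset.sum_congr rfl fun i _ => ?_
    rw [star_mul, hts.star_eq]; simp only [mul_assoc]
  have hta : t * (a * a) = 1 := by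
    rw [ht, mul_assoc, ← mul_assoc a' a a, ha'a, one_mul, ha'a]
  have hat : a * a * t = 1 := by
    rw [ht, mul_assoc, ← mul_assoc a a' a', haa', one_mul, haa']
  have h1 : 1 - t * s * t = (ε ^ 2) • (t * t) := by
    have : t * (s + (ε ^ 2) • (1 : Car M)) * t = 1 := by
      rw [← ha4, ← mul_assoc t, hta, one_mul, hat]
    rw [mul_add, add_mul, mul_smul_comm, mul_one, smul_mul_assoc] at this
    rw [← this]; abel
  have hD0 : 0 ≤ 1 - t * s * t := by
    rw [h1]
    refine smul_nonneg (by positivity) ?_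
    have := star_mul_self_nonneg t
    rwa [hts.star_eq] at this
  have hf0 : 0 ≤ t * s * t := by
    have := star_left_conjugate_nonneg hs0 t
    rwa [hts.star_eq] at this
  have hf1 : ‖t * s * t‖ ≤ 1 := norm_le_one_of hf0 (sub_nonneg.mp hD0)
  have hD1 : ‖1 - t * s * t‖ ≤ 1 := norm_le_one_of hD0 (by rw [sub_le_self_iff]; exact hf0)
  have htn : ε * ‖t‖ ≤ 1 := by
    have := norm_le_one_of (smul_nonneg hε.le ht0) hale
    rwa [norm_smul, Real.norm_eq_abs, abs_of_pos hε] at this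
  refine ⟨t, hts, ?_⟩
  rw [hf]
  refine ⟨hD0, hD1, fun i hi => ?_⟩
  have hDs : star (1 - t * s * t) = 1 - t * s * t := (IsSelfAdjoint.of_nonneg hD0).star_eq
  have e1 : ‖(1 - t * s * t) * star (y i)‖ * ‖(1 - t * s * t) * star (y i)‖ =
      ‖(1 - t * s * t) * (star (y i) * y i) * (1 - t * s * t)‖ := by
    rw [← CStarRing.norm_self_mul_star, star_mul, star_star, hDs]; simp only [mul_assoc]
  have e2 : (1 - t * s * t) * (star (y i) * y i) * (1 - t * s * t) ≤
      (1 - t * s * t) * s * (1 - t * s * t) := by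
    have h2 : star (y i) * y i ≤ s :=
      Finset.single_le_sum (f := fun i => star (y i) * y i) (fun i _ => star_mul_self_nonneg _) hi
    have := star_left_conjugate_le_conjugate h2 (1 - t * s * t)
    rwa [hDs] at this
  have e3 : 0 ≤ (1 - t * s * t) * (star (y i) * y i) * (1 - t * s * t) := by
    have := star_left_conjugate_nonneg (star_mul_self_nonneg (y i)) (1 - t * s * t)
    rwa [hDs] at this
  have e4 : (1 - t * s * t) * s * (1 - t * s * t) = (ε ^ 4) • (t * (t * s * t) * t) := by
    rw [h1]
    simp only [smul_mul_assoc, mul_smul_comm, smul_smul, mul_assoc]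
    congr 1; ring
  have e5 : ‖(1 - t * s * t) * s * (1 - t * s * t)‖ ≤ ε ^ 2 := by
    rw [e4, norm_smul, Real.norm_eq_abs, abs_of_pos (by positivity)]
    calc ε ^ 4 * ‖t * (t * s * t) * t‖ ≤ ε ^ 4 * (‖t‖ * 1 * ‖t‖) := by
          gcongr
          refine (norm_mul_le _ _).trans ?_
          gcongr
          refine (norm_mul_le _ _).trans ?_
          gcongr
      _ = ε ^ 2 * ((ε * ‖t‖) * (ε * ‖t‖)) := by ring
      _ ≤ ε ^ 2 * (1 * 1) := by gcongr
      _ = ε ^ 2 := by ring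
  have e6 := (e1.le.trans (CStarAlgebra.norm_le_norm_of_nonneg_of_le e3 e2)).trans e5
  rw [sq] at e6
  exact le_of_not_gt fun hlt => by nlinarith [norm_nonneg ((1 - t * s * t) * star (y i))]

lemma carrier (Y : Set (Car M)) (hY : ∀ y ∈ Y, ∀ r, y * r ∈ Y) :
    ∃ c : Car M, Cen c ∧ IsSelfAdjoint c ∧ c * c = c ∧ (∀ y ∈ Y, y * c = y) ∧
      ∀ g : Car M →L[ℂ] ℂ, Nml g → ∀ δ : ℝ, 0 < δ → ∃ (n : ℕ) (b : Fin n → Car M),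
        (∀ i, b i ∈ Y) ∧ 0 ≤ 1 - ∑ i, star (b i) * b i ∧
        ‖g (∑ i, star (b i) * b i) - g c‖ < δ := by
  set S : Set H := {u | ∃ y ∈ Y, ∃ v, u = op (star y) v} with hS
  set K : Submodule ℂ H := (Submodule.span ℂ S).topologicalClosure with hK
  have hKc : IsClosed (K : Set H) := Submodule.isClosed_topologicalClosure _
  haveI : CompleteSpace K := hKc.completeSpace_coe
  set P : H →L[ℂ] H := K.starProjection with hP
  have hPP : IsStarProjection P := isStarProjection_starProjection
  have hPr : ∀ u, u ∈ K → P u = u := fun u hu => Submodule.starProjection_eq_self_iff.mpr hu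
  have hPm : ∀ u, P u ∈ K := fun u => Submodule.starProjection_apply_mem _ u
  have hrange : ∀ u, u ∈ P.range ↔ u ∈ K := by
    intro u
    constructor
    · rintro ⟨v, rfl⟩; exact hPm v
    · intro hu; exact ⟨u, hPr u hu⟩
  -- invariance
  have hinv : ∀ T : H →L[ℂ] H, (∀ u ∈ S, T u ∈ S) → ∀ u ∈ K, T u ∈ K := by
    intro T hT
    have h1 : Submodule.span ℂ S ≤ K.comap (T : H →ₗ[ℂ] H) := by
      rw [Submodule.span_le]
      intro u hu
      exact Submodule.le_topologicalClosure _ (Submodule.subset_span (hT u hu))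
    have h2 : IsClosed ((K.comap (T : H →ₗ[ℂ] H) : Submodule ℂ H) : Set H) :=
      hKc.preimage T.continuous
    exact Submodule.topologicalClosure_minimal _ h1 h2
  have hPM : P ∈ M := by
    rw [VonNeumannAlgebra.IsStarProjection.mem_iff hPP]
    intro y hy
    rw [Module.End.mem_invtSubmodule]
    intro u hu
    rw [Submodule.mem_comap]
    refine (hrange _).mpr (hinv y ?_ u ((hrange u).mp hu))
    rintro _ ⟨w, hw, v, rfl⟩
    refine ⟨w, hw, y v, ?_⟩
    have := (vn_mem_iff M _).mp (op_mem (star w)) y hy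
    exact congrArg (fun z : H →L[ℂ] H => z v) this
  have hPM' : P ∈ M.commutant := by
    rw [VonNeumannAlgebra.IsStarProjection.mem_iff hPP]
    intro y hy
    rw [VonNeumannAlgebra.commutant_commutant] at hy
    rw [Module.End.mem_invtSubmodule]
    intro u hu
    rw [Submodule.mem_comap]
    refine (hrange _).mpr (hinv y ?_ u ((hrange u).mp hu))
    rintro _ ⟨w, hw, v, rfl⟩
    refine ⟨w * star (Car.mk y hy), hY w hw _, v, ?_⟩
    rw [star_mul, star_star, map_mul]
    rfl
  set c : Car M := Car.mk P hPM with hc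
  have hcs : IsSelfAdjoint c := by
    apply op_inj
    rw [map_star]
    exact hPP.isSelfAdjoint.star_eq
  have hcy : ∀ y ∈ Y, c * star y = star y := by
    intro y hy
    apply op_inj
    rw [map_mul]
    ext v
    change P (op (star y) v) = _
    exact hPr _ (Submodule.le_topologicalClosure _ (Submodule.subset_span ⟨y, hy, v, rfl⟩))
  have hyc : ∀ y ∈ Y, y * c = y := by
    intro y hy
    have := congrArg star (hcy y hy)
    rwa [star_mul, star_star, hcs.star_eq] at this
  refine ⟨c, fun x => ?_, hcs, ?_, hyc, ?_⟩
  · apply op_inj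
    rw [map_mul, map_mul]
    exact ((VonNeumannAlgebra.mem_commutant_iff.mp hPM') _ (op_mem x)).symm
  · apply op_inj
    rw [map_mul]
    exact hPP.isIdempotentElem
  · intro g hg δ hδ
    have hex : ∀ p : Finset Y × ℝ, ∃ t : Car M, 0 < p.2 →
      0 ≤ 1 - ∑ i ∈ p.1, star (i.1 * t) * (i.1 * t) ∧
      ‖1 - ∑ i ∈ p.1, star (i.1 * t) * (i.1 * t)‖ ≤ 1 ∧
      ∀ i ∈ p.1, ‖(1 - ∑ i ∈ p.1, star (i.1 * t) * (i.1 * t)) * star (i.1)‖ ≤ p.2 := by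
      intro p
      by_cases h : 0 < p.2
      · obtain ⟨t, -, ht⟩ := reg_step p.1 (fun i : Y => i.1) h
        exact ⟨t, fun _ => ht⟩
      · exact ⟨0, fun h' => absurd h' h⟩
    choose t ht using hex
    set D : Finset Y × ℝ → Car M := fun p => 1 - ∑ i ∈ p.1, star (i.1 * t p) * (i.1 * t p) with hD
    set L : Filter (Finset Y × ℝ) := Filter.atTop ×ˢ nhdsWithin 0 (Set.Ioi 0) with hL
    have hLpos : ∀ᶠ p in L, 0 < p.2 :=
      Filter.Eventually.prod_inr (p := fun a : ℝ => 0 < a) self_mem_nhdsWithin Filter.atTop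
    have hLsnd : Filter.Tendsto Prod.snd L (nhds (0:ℝ)) :=
      Filter.tendsto_snd.mono_right nhdsWithin_le_nhds
    -- convergence on vectors
    have hconv : ∀ u ∈ K, Filter.Tendsto (fun p => op (D p) u) L (nhds 0) := by
      let V : Submodule ℂ H :=
        { carrier := {u | Filter.Tendsto (fun p => op (D p) u) L (nhds 0)}
          add_mem' := by
            intro a b ha hb
            have := Filter.Tendsto.add ha hb
            simpa using this
          zero_mem' := by simp
          smul_mem' := by
            intro z a ha
            have := Filter.Tendsto.const_smul ha z
            simpa using this }
      have hV1 : Submodule.span ℂ S ≤ V := by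
        rw [Submodule.span_le]
        rintro _ ⟨y, hy, v, rfl⟩
        change Filter.Tendsto (fun p => op (D p) (op (star y) v)) L (nhds 0)
        have hev : ∀ᶠ p in L, ‖op (D p) (op (star y) v)‖ ≤ p.2 * ‖v‖ := by
          have h1 : ∀ᶠ p in L, {(⟨y, hy⟩ : Y)} ≤ p.1 :=
            (Filter.eventually_ge_atTop _).prod_inl _
          filter_upwards [h1, hLpos] with p hp1 hp2
          have := (ht p hp2).2.2 ⟨y, hy⟩ (hp1 (Finset.mem_singleton_self _))
          have e : op (D p) (op (star y) v) = op (D p * star y) v := by rw [map_mul]; rfl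
          rw [e]
          refine (op_apply_le _ _).trans ?_
          gcongr
        refine squeeze_zero_norm' hev ?_
        have := hLsnd.mul_const ‖v‖
        rwa [zero_mul] at this
      have hV2 : IsClosed (V : Set H) := by
        refine isClosed_of_closure_subset fun u hu => ?_
        change Filter.Tendsto (fun p => op (D p) u) L (nhds 0)
        rw [Metric.tendsto_nhds]
        intro ε hε
        obtain ⟨w, hw, hd⟩ := Metric.mem_closure_iff.mp hu (ε / 2) (by positivity)
        have hw' : Filter.Tendsto (fun p => op (D p) w) L (nhds 0) := hw
        filter_upwards [Metric.tendsto_nhds.mp hw' (ε / 2) (by positivity), hLpos] with p hp1 hp2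
        rw [dist_zero_right] at hp1 ⊢
        rw [dist_eq_norm] at hd
        have e : op (D p) u = op (D p) (u - w) + op (D p) w := by
          rw [← map_add, sub_add_cancel]
        rw [e]
        refine (norm_add_le _ _).trans_lt ?_
        have h3 : ‖op (D p) (u - w)‖ ≤ 1 * ‖u - w‖ := by
          refine (op_apply_le _ _).trans ?_
          gcongr
          exact (ht p hp2).2.1
        linarith
      exact Submodule.topologicalClosure_minimal _ hV1 hV2
    obtain ⟨x, w, hx, hw, hsum⟩ := hg
    have hnorm := hasSum_vecF hx hw hsum
    obtain ⟨F, hF⟩ := (Metric.tendsto_nhds.mp hnorm (δ / 4) (by positivity)).exists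
    rw [dist_eq_norm] at hF
    have hcn : ‖c‖ ≤ 1 := by
      rw [← op_norm]
      exact Submodule.starProjection_norm_le K
    have hlim : Filter.Tendsto (fun p => (∑ n ∈ F, vecF M (x n) (w n)) (D p * c)) L (nhds 0) := by
      have h1 : ∀ n ∈ F, Filter.Tendsto (fun p => vecF M (x n) (w n) (D p * c)) L (nhds 0) := by
        intro n _
        have h2 := hconv (P (w n)) (hPm _)
        have h3 : Filter.Tendsto (fun p => ⟪x n, op (D p) (P (w n))⟫) L (nhds ⟪x n, (0 : H)⟫) :=
          Filter.Tendsto.inner tendsto_const_nhds h2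
        rw [inner_zero_right] at h3
        refine h3.congr fun p => ?_
        rw [vecF_apply, map_mul]; rfl
      have h2 := tendsto_finset_sum F h1
      rw [Finset.sum_const_zero] at h2
      refine h2.congr fun p => ?_
      rw [funsum_apply]
    obtain ⟨p, hp1, hp2⟩ := ((Metric.tendsto_nhds.mp hlim (δ / 2) (by positivity)).and hLpos).exists
    rw [dist_zero_right] at hp1
    obtain ⟨q1, q2, q3⟩ := ht p hp2
    have hDc : D p * c = c - ∑ i ∈ p.1, star (i.1 * t p) * (i.1 * t p) := by
      rw [hD, sub_mul, one_mul, Finset.sum_mul]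
      congr 1
      refine Finset.sum_congr rfl fun i _ => ?_
      rw [mul_assoc, hyc _ (hY _ i.2 _)]
    refine ⟨p.1.card, fun i => (p.1.equivFin.symm i).1.1 * t p, fun i => hY _ (Subtype.property _) _, ?_⟩
    have hre : ∑ i : Fin p.1.card, star ((p.1.equivFin.symm i).1.1 * t p) *
        ((p.1.equivFin.symm i).1.1 * t p) = ∑ i ∈ p.1, star (i.1 * t p) * (i.1 * t p) := by
      rw [p.1.equivFin.symm.sum_comp (fun i => star (i.1.1 * t p) * (i.1.1 * t p))]
      exact Finset.sum_coe_sort p.1 (fun i => star (i.1 * t p) * (i.1 * t p))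
    rw [hre]
    refine ⟨q1, ?_⟩
    rw [norm_sub_rev, ← map_sub, ← hDc]
    have e : g (D p * c) = (∑ n ∈ F, vecF M (x n) (w n)) (D p * c) -
        ((∑ n ∈ F, vecF M (x n) (w n)) - g) (D p * c) := by
      rw [ContinuousLinearMap.sub_apply]; abel
    have hb : ‖((∑ n ∈ F, vecF M (x n) (w n)) - g) (D p * c)‖ ≤ δ / 4 * (1 * 1) := by
      refine (ContinuousLinearMap.le_opNorm _ _).trans ?_
      gcongr
      refine (norm_mul_le _ _).trans ?_
      gcongr
    rw [e]
    refine (norm_sub_le _ _).trans_lt ?_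
    linarith

end Carrier

set_option linter.all false
section Jordan

lemma norm_le_one_of_sa {u : Car M} (hu : IsSelfAdjoint u) (h0 : 0 ≤ 1 + u) (h1 : 0 ≤ 1 - u) :
    ‖u‖ ≤ 1 := by
  have hc : Commute (1 - u) (1 + u) := by
    rw [commute_iff_eq]; noncomm_ring
  have h := Commute.mul_nonneg h1 h0 hc
  have e : (1 - u) * (1 + u) = 1 - u * u := by noncomm_ring
  rw [e, sub_nonneg] at h
  have h2 : 0 ≤ u * u := by
    have := star_mul_self_nonneg u
    rwa [hu.star_eq] at this
  have h3 := norm_le_one_of h2 h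
  have h4 : ‖u * u‖ = ‖u‖ * ‖u‖ := by
    have := CStarRing.norm_star_mul_self (x := u)
    rwa [hu.star_eq] at this
  rw [h4] at h3
  nlinarith [norm_nonneg u]

lemma sa_bounds {u : Car M} (hu : IsSelfAdjoint u) {r : ℝ} (h : ‖u‖ ≤ r) :
    0 ≤ r • (1 : Car M) + u ∧ 0 ≤ r • (1 : Car M) - u := by
  have h1 := hu.le_algebraMap_norm_self
  have h2 := hu.neg_algebraMap_norm_le_self
  rw [Algebra.algebraMap_eq_smul_one] at h1 h2
  have h3 : ‖u‖ • (1 : Car M) ≤ r • (1 : Car M) := by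
    rw [← sub_nonneg, ← sub_smul]
    exact smul_nonneg (by linarith) zero_le_one
  constructor
  · have := h2.trans' (neg_le_neg h3)
    rw [neg_le_iff_add_nonneg] at this
    rwa [add_comm]
  · rw [sub_nonneg]; exact h1.trans h3

/-- the centralizer of a hermitian functional -/
def cenF (ω : Car M →L[ℂ] ℂ) (hh : ∀ a, ω (star a) = conj (ω a)) : StarSubalgebra ℂ (Car M) where
  carrier := {a | ∀ x, ω (a * x) = ω (x * a)}
  mul_mem' := by
    intro a b ha hb x
    have h1 := ha (b * x)
    have h2 := hb (x * a)
    rw [mul_assoc, h1, mul_assoc, h2, mul_assoc]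
  add_mem' := by
    intro a b ha hb x
    rw [add_mul, mul_add, map_add, map_add, ha x, hb x]
  algebraMap_mem' := by
    intro r x
    rw [Algebra.commutes]
  star_mem' := by
    intro a ha x
    have h1 := ha (star x)
    have h2 := hh (star x * a)
    have h3 := hh (a * star x)
    rw [star_mul, star_star] at h2 h3
    rw [h2, h3, h1]

lemma cenF_closed (ω : Car M →L[ℂ] ℂ) (hh : ∀ a, ω (star a) = conj (ω a)) :
    IsClosed (cenF ω hh : Set (Car M)) := by
  have : (cenF ω hh : Set (Car M)) = ⋂ x, {a | ω (a * x) = ω (x * a)} := by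
    ext a; rw [Set.mem_iInter]; rfl
  rw [this]
  refine isClosed_iInter fun x => isClosed_eq ?_ ?_
  · exact ω.continuous.comp (continuous_id.mul continuous_const)
  · exact ω.continuous.comp (continuous_const.mul continuous_id)

lemma sqrt_mem_cenF (ω : Car M →L[ℂ] ℂ) (hh : ∀ a, ω (star a) = conj (ω a)) {p : Car M}
    (hp : 0 ≤ p) (h : ∀ x, ω (p * x) = ω (x * p)) (x : Car M) :
    ω (CFC.sqrt p * x) = ω (x * CFC.sqrt p) := by
  have e : CFC.sqrt p = cfc Real.sqrt p := by
    rw [CFC.sqrt_eq_real_sqrt p hp, cfcₙ_eq_cfc]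
  have : cfc Real.sqrt p ∈ cenF ω hh :=
    haveI : IsClosed (cenF ω hh : Set (Car M)) := cenF_closed ω hh
    cfc_mem (𝕜 := ℝ) (𝕜' := ℂ) (s := cenF ω hh) Real.sqrt (show p ∈ cenF ω hh from h)
  rw [← e] at this
  exact this x

lemma pos_of_unit {f : Car M →L[ℂ] ℂ} (hh : ∀ a, f (star a) = conj (f a))
    (h : ∀ x : Car M, 0 ≤ x → x ≤ 1 → 0 ≤ (f x).re) : Pos f := by
  intro a
  have h0 : 0 ≤ (f (star a * a)).re := by
    set r : ℝ := ‖a‖ ^ 2 + 1 with hr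
    have hr0 : 0 < r := by positivity
    have h1 : 0 ≤ r⁻¹ • (star a * a) := smul_nonneg (by positivity) (star_mul_self_nonneg a)
    have h2 : r⁻¹ • (star a * a) ≤ 1 := by
      rw [← CStarAlgebra.norm_le_one_iff_of_nonneg _ h1, norm_smul, CStarRing.norm_star_mul_self,
        Real.norm_eq_abs, abs_of_pos (by positivity), ← div_eq_inv_mul, div_le_one hr0, hr]
      nlinarith
    have h3 := h _ h1 h2
    rw [map_rsmul, Complex.re_ofReal_mul] at h3
    exact (mul_nonneg_iff_of_pos_left (by positivity)).mp h3
  have h1 := hermitian_im hh (IsSelfAdjoint.star_mul_self a)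
  rw [Complex.nonneg_iff]
  exact ⟨h0, h1.symm⟩

lemma jordan {ω : Car M →L[ℂ] ℂ} (hω : Nml ω) (hh : ∀ a, ω (star a) = conj (ω a)) :
    ∃ (q r s : Car M) (ωp ωm : Car M →L[ℂ] ℂ), star q * q + star r * r = 1 ∧ ‖s‖ ≤ 1 ∧
      Pos ωp ∧ Pos ωm ∧ Nml ωp ∧ Nml ωm ∧ (∀ x, ωp x = ω (star q * x * q)) ∧
      (∀ x, ωm x = - ω (star r * x * r)) ∧ (∀ x, ω x = ωp x - ωm x) ∧
      (∀ c, ω (c * s) = ωp c + ωm c) := by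
  obtain ⟨F, hF1, hF2⟩ := exists_dual_vector'' ℂ ω
  obtain ⟨T, hT1, hT2⟩ := exists_T F
  have hωT : ω T = (‖ω‖ : ℂ) := by rw [← hT2 ω hω, hF2]; rfl
  have hTn : ‖T‖ ≤ 1 := hT1.trans hF1
  set s : Car M := (1 / 2 : ℝ) • (T + star T) with hs
  have hss : IsSelfAdjoint s := (IsSelfAdjoint.all (1 / 2 : ℝ)).smul (IsSelfAdjoint.add_star_self T)
  have hsn : ‖s‖ ≤ 1 := by
    rw [hs, norm_smul, Real.norm_eq_abs, abs_of_pos (by norm_num)]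
    have := norm_add_le T (star T)
    rw [norm_star] at this
    linarith
  have hωs : ω s = (‖ω‖ : ℂ) := by
    rw [hs, map_rsmul, map_add, hh, hωT, Complex.conj_ofReal]; push_cast; ring
  have hf : Pos (lmul ω s) := by
    refine pos_of_norm_le (N := ‖ω‖) (by rw [lmul_apply, mul_one, hωs]) ?_
    refine ContinuousLinearMap.opNorm_le_bound _ (norm_nonneg _) fun x => ?_
    rw [lmul_apply]
    refine (ω.le_opNorm _).trans ?_
    gcongr
    refine (norm_mul_le _ _).trans ?_
    calc ‖s‖ * ‖x‖ ≤ 1 * ‖x‖ := by gcongr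
      _ = ‖x‖ := one_mul _
  have hcs : ∀ x, ω (s * x) = ω (x * s) := by
    intro x
    have h1 := hf.herm (star x)
    rw [lmul_apply, lmul_apply, star_star] at h1
    rw [h1, ← hh, star_mul, star_star, hss.star_eq]
  obtain ⟨hb0, hb1⟩ := sa_bounds hss hsn
  rw [one_smul] at hb0 hb1
  set p : Car M := (1 / 2 : ℝ) • (1 + s) with hp
  set p' : Car M := (1 / 2 : ℝ) • (1 - s) with hp'
  have hp0 : 0 ≤ p := smul_nonneg (by norm_num) hb0
  have hp0' : 0 ≤ p' := smul_nonneg (by norm_num) hb1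
  have hpp : p + p' = 1 := by
    rw [hp, hp', ← smul_add, show (1 + s) + (1 - s) = (2 : ℝ) • (1 : Car M) by rw [two_smul]; abel,
      smul_smul]; norm_num
  have hpm : p - p' = s := by
    rw [hp, hp', ← smul_sub, show (1 + s) - (1 - s) = (2 : ℝ) • s by rw [two_smul]; abel,
      smul_smul]; norm_num
  have hcp : ∀ x, ω (p * x) = ω (x * p) := by
    intro x
    rw [hp, smul_mul_assoc, mul_smul_comm, map_rsmul, map_rsmul, add_mul, mul_add, one_mul, mul_one,
      map_add, map_add, hcs]
  have hcp' : ∀ x, ω (p' * x) = ω (x * p') := by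
    intro x
    rw [hp', smul_mul_assoc, mul_smul_comm, map_rsmul, map_rsmul, sub_mul, mul_sub, one_mul, mul_one,
      map_sub, map_sub, hcs]
  set q : Car M := CFC.sqrt p with hq
  set r : Car M := CFC.sqrt p' with hr
  have hqs : star q = q := (IsSelfAdjoint.of_nonneg (CFC.sqrt_nonneg p)).star_eq
  have hrs : star r = r := (IsSelfAdjoint.of_nonneg (CFC.sqrt_nonneg p')).star_eq
  have hqq : q * q = p := CFC.sqrt_mul_sqrt_self p hp0
  have hrr : r * r = p' := CFC.sqrt_mul_sqrt_self p' hp0'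
  have hqx : ∀ x, ω (q * x * q) = ω (x * p) := by
    intro x
    rw [mul_assoc, sqrt_mem_cenF ω hh hp0 hcp, mul_assoc, hqq]
  have hrx : ∀ x, ω (r * x * r) = ω (x * p') := by
    intro x
    rw [mul_assoc, sqrt_mem_cenF ω hh hp0' hcp', mul_assoc, hrr]
  have herm1 : ∀ b : Car M, star b = b → ∀ a, sand ω b b (star a) = conj (sand ω b b a) := by
    intro b hb a
    rw [sand_apply, sand_apply, ← hh, star_mul, star_mul, hb, mul_assoc]
  have hbound : ∀ u : Car M, ‖u‖ ≤ 1 → (ω u).re ≤ ‖ω‖ := by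
    intro u hu
    refine (Complex.re_le_norm _).trans ((ω.le_opNorm u).trans ?_)
    calc ‖ω‖ * ‖u‖ ≤ ‖ω‖ * 1 := by gcongr
      _ = _ := mul_one _
  have hsa2 : ∀ b x : Car M, star b = b → IsSelfAdjoint x → IsSelfAdjoint (b * x * b) := by
    intro b x hb hx
    rw [IsSelfAdjoint, star_mul, star_mul, hb, hx.star_eq, mul_assoc]
  have hconj : ∀ b x : Car M, star b = b → 0 ≤ x → x ≤ 1 → 0 ≤ b * x * b ∧ b * x * b ≤ b * b := by
    intro b x hb h0 h1
    have e1 := star_left_conjugate_nonneg h0 b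
    have e2 := star_left_conjugate_le_conjugate h1 b
    rw [hb] at e1 e2
    rw [mul_one] at e2
    exact ⟨e1, e2⟩
  have hPp : Pos (sand ω q q) := by
    refine pos_of_unit (herm1 q hqs) fun x h0 h1 => ?_
    obtain ⟨e1, e2⟩ := hconj q x hqs h0 h1
    rw [hqq] at e2
    have hu : ‖s - (2 : ℝ) • (q * x * q)‖ ≤ 1 := by
      refine norm_le_one_of_sa (hss.sub ((IsSelfAdjoint.all (2 : ℝ)).smul
        (hsa2 q x hqs (IsSelfAdjoint.of_nonneg h0)))) ?_ ?_
      · have : (1 : Car M) + (s - (2 : ℝ) • (q * x * q)) = (2 : ℝ) • (p - q * x * q) := by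
          rw [← hpm, ← hpp, two_smul, two_smul]; abel
        rw [this]; exact smul_nonneg (by norm_num) (sub_nonneg.mpr e2)
      · have : (1 : Car M) - (s - (2 : ℝ) • (q * x * q)) = (1 - s) + (2 : ℝ) • (q * x * q) := by abel
        rw [this]; exact add_nonneg hb1 (smul_nonneg (by norm_num) e1)
    have := hbound _ hu
    rw [map_sub, hωs, map_rsmul, Complex.sub_re, Complex.re_ofReal_mul, Complex.ofReal_re] at this
    rw [sand_apply]
    linarith
  have hPm : Pos (-(sand ω r r)) := by
    refine pos_of_unit (fun a => ?_) fun x h0 h1 => ?_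
    · rw [ContinuousLinearMap.neg_apply, ContinuousLinearMap.neg_apply, herm1 r hrs, map_neg]
    obtain ⟨e1, e2⟩ := hconj r x hrs h0 h1
    rw [hrr] at e2
    have hu : ‖s + (2 : ℝ) • (r * x * r)‖ ≤ 1 := by
      refine norm_le_one_of_sa (hss.add ((IsSelfAdjoint.all (2 : ℝ)).smul
        (hsa2 r x hrs (IsSelfAdjoint.of_nonneg h0)))) ?_ ?_
      · have : (1 : Car M) + (s + (2 : ℝ) • (r * x * r)) = (1 + s) + (2 : ℝ) • (r * x * r) := by abel
        rw [this]; exact add_nonneg hb0 (smul_nonneg (by norm_num) e1)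
      · have : (1 : Car M) - (s + (2 : ℝ) • (r * x * r)) = (2 : ℝ) • (p' - r * x * r) := by
          rw [← hpm, ← hpp, two_smul, two_smul]; abel
        rw [this]; exact smul_nonneg (by norm_num) (sub_nonneg.mpr e2)
    have := hbound _ hu
    rw [map_add, hωs, map_rsmul, Complex.add_re, Complex.re_ofReal_mul, Complex.ofReal_re] at this
    rw [ContinuousLinearMap.neg_apply, sand_apply, Complex.neg_re]
    linarith
  refine ⟨q, r, s, sand ω q q, -(sand ω r r), by rw [hqs, hrs, hqq, hrr, hpp], hsn, hPp, hPm,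
    hω.sand _ _, (hω.sand _ _).neg, fun x => by rw [hqs, sand_apply], fun x => by
      rw [hrs, ContinuousLinearMap.neg_apply, sand_apply], fun x => ?_, fun c => ?_⟩
  · rw [ContinuousLinearMap.neg_apply, sand_apply, sand_apply, hqx, hrx, sub_neg_eq_add, ← map_add,
      ← mul_add, hpp, mul_one]
  · rw [ContinuousLinearMap.neg_apply, sand_apply, sand_apply, hqx, hrx, ← sub_eq_add_neg, ← map_sub,
      ← mul_sub, hpm]

end Jordan

section LemmaC

lemma proj_nonneg {c : Car M} (hs : IsSelfAdjoint c) (hp : c * c = c) : 0 ≤ c := by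
  have := star_mul_self_nonneg c
  rwa [hs.star_eq, hp] at this

lemma lmul_pos {G : Car M →L[ℂ] ℂ} (hG : Pos G) {c : Car M} (hc : Cen c) (h0 : 0 ≤ c) :
    Pos (lmul G c) := by
  obtain ⟨d, hd, hdc, rfl⟩ := central_sqrt h0 hc
  refine hG.conj d fun x => ?_
  have e : d * d * x = d * x * d := by rw [mul_assoc, (hdc x).eq, ← mul_assoc, (hdc x).eq]
  rw [lmul_apply, hd.star_eq, e]
  

lemma lemmaC_aux {δ : ℝ} (hδ : 0 < δ) (N : ℕ) : ∀ h : Car M, 0 ≤ h → h ≤ (N * δ) • (1 : Car M) →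
    ∀ G : Car M →L[ℂ] ℂ, Pos G → Nml G → ∀ η : ℝ, 0 < η → ∃ φ : Car M →L[ℂ] Car M, IsE φ ∧
      ∃ z : Car M, Cen z ∧ h ≤ z + δ • 1 ∧ (G z).re - η ≤ (G (φ h)).re := by
  induction N with
  | zero =>
    intro h h0 h1 G hG _ η hη
    refine ⟨_, IsE.id, 0, Cen.zero, ?_, ?_⟩
    · rw [zero_add]
      refine h1.trans ?_
      rw [Nat.cast_zero, zero_mul, zero_smul]
      exact smul_nonneg hδ.le zero_le_one
    · rw [map_zero, ContinuousLinearMap.id_apply, Complex.zero_re]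
      have := hG.re_nonneg h0
      linarith
  | succ N ih =>
    intro h h0 h1 G hG hGn η hη
    set l : ℝ := N * δ with hl
    have hl0 : 0 ≤ l := by positivity
    have hhs : IsSelfAdjoint h := IsSelfAdjoint.of_nonneg h0
    set k : Car M := h - l • 1 with hk
    have hks : IsSelfAdjoint k := hhs.sub ((IsSelfAdjoint.all l).smul (IsSelfAdjoint.one _))
    set y : Car M := k⁺ with hy
    have hy0 : 0 ≤ y := CFC.posPart_nonneg k
    have hn0 : 0 ≤ k⁻ := CFC.negPart_nonneg k
    have hys : star y = y := (IsSelfAdjoint.of_nonneg hy0).star_eq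
    have hkk : k = y - k⁻ := (CFC.posPart_sub_negPart k hks).symm
    have hyn : y * k⁻ = 0 := CFC.posPart_mul_negPart k
    obtain ⟨c, hcc, hcs, hcp, hyc, happ⟩ := carrier {x : Car M | ∃ r, x = y * r} (by
      rintro _ ⟨r, rfl⟩ r'; exact ⟨r * r', mul_assoc _ _ _⟩)
    have hyc' : y * c = y := hyc y ⟨1, (mul_one y).symm⟩
    have hc0 : 0 ≤ c := proj_nonneg hcs hcp
    set c' : Car M := 1 - c with hc'
    have hc'c : Cen c' := Cen.one.sub hcc
    have hc's : IsSelfAdjoint c' := (IsSelfAdjoint.one _).sub hcs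
    have hc'p : c' * c' = c' := by
      rw [hc', mul_sub, mul_one, sub_mul, one_mul, hcp]; abel
    have hc'0 : 0 ≤ c' := proj_nonneg hc's hc'p
    have hcut : ∀ {e : Car M}, Cen e → 0 ≤ e → ∀ {a b : Car M}, a ≤ b → e * a ≤ e * b := by
      intro e he he0 a b hab
      rw [← sub_nonneg, ← mul_sub]
      exact Commute.mul_nonneg he0 (sub_nonneg.mpr hab) (he _)
    have hc'k : c' * k ≤ 0 := by
      have : c' * y = 0 := by rw [hc', sub_mul, one_mul, (hcc y).eq, hyc', sub_self]
      rw [hkk, mul_sub, this, zero_sub, neg_nonpos]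
      exact Commute.mul_nonneg hc'0 hn0 (hc'c _)
    have hle' : c' * h ≤ l • c' := by
      have e : c' * k = c' * h - l • c' := by rw [hk, mul_sub, mul_smul_comm, mul_one]
      rw [e, sub_nonpos] at hc'k
      exact hc'k
    have hc'1 : c' ≤ 1 := by rw [hc', sub_le_self_iff]; exact hc0
    -- induction hypothesis
    obtain ⟨φ', hφ', z', hz', hhz, hGz⟩ := ih (c' * h) (Commute.mul_nonneg hc'0 h0 (hc'c _))
      (hle'.trans (smul_le_smul_of_nonneg_left hc'1 hl0)) (lmul G c') (lmul_pos hG hc'c hc'0) (hGn.lmul _)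
      (η / 2) (by positivity)
    rw [lmul_apply, lmul_apply, hφ'.central hc'c, ← mul_assoc, hc'p] at hGz
    -- the part under c
    obtain ⟨n, b, hb, hb1, hbG⟩ := happ (lmul G c) (hGn.lmul c) (η / (2 * (l + 1))) (by positivity)
    set f : Car M := ∑ i, star (b i) * b i with hf
    obtain ⟨d, hd⟩ : ∃ d : Car M, star d * d = 1 - f :=
      ⟨CFC.sqrt (1 - f), by
        rw [(IsSelfAdjoint.of_nonneg (CFC.sqrt_nonneg (1 - f))).star_eq,
          CFC.sqrt_mul_sqrt_self _ hb1]⟩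
    obtain ⟨φ'', hφ'', hφx⟩ := IsE.comb (ι := Option (Fin n)) (M := M)
      (φ := fun _ => ContinuousLinearMap.id ℂ (Car M))
      (fun _ => IsE.id) (b := fun o => o.elim d b) (by
        rw [Fintype.sum_option]
        simp only [Option.elim_none, Option.elim_some]
        rw [hd, ← hf]; abel)
    have hφh : l • f ≤ φ'' h := by
      rw [hφx, Fintype.sum_option]
      simp only [Option.elim_none, Option.elim_some, ContinuousLinearMap.id_apply]
      have e1 : 0 ≤ star d * h * d := star_left_conjugate_nonneg h0 d
      have e2 : l • f ≤ ∑ i, star (b i) * h * b i := by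
        rw [hf, Finset.smul_sum]
        refine Finset.sum_le_sum fun i _ => ?_
        obtain ⟨r, hr⟩ := hb i
        rw [← sub_nonneg]
        have e3 : star (b i) * h * b i - l • (star (b i) * b i) = star r * (y * k * y) * r := by
          rw [hr, hk, star_mul, hys]
          simp only [mul_sub, sub_mul, mul_smul_comm, smul_mul_assoc, mul_one, mul_assoc]
        rw [e3]
        refine star_left_conjugate_nonneg ?_ r
        rw [hkk, mul_sub, hyn, sub_zero]
        have := star_left_conjugate_nonneg hy0 y
        rwa [hys] at this
      calc l • f ≤ ∑ i, star (b i) * h * b i := e2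
        _ ≤ _ := le_add_of_nonneg_left e1
    obtain ⟨φ, hφ, hφe⟩ := hφ''.cut hφ' hcc hcs hcp
    refine ⟨φ, hφ, l • c + c' * z', (hcc.rsmul l).add (hc'c.mul hz'), ?_, ?_⟩
    · have e1 : h = c * h + c' * h := by rw [hc', ← add_mul]; simp
      have e2 : c * h ≤ (l + δ) • c := by
        have := hcut hcc hc0 h1
        rw [mul_smul_comm, mul_one] at this
        refine this.trans (le_of_eq ?_)
        congr 1
        rw [hl]; push_cast; ring
      have e3 : c' * h ≤ c' * z' + δ • c' := by
        have := hcut hc'c hc'0 hhz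
        rwa [← mul_assoc, hc'p, mul_add, mul_smul_comm, mul_one] at this
      have e4 : l • c + c' * z' + δ • (1 : Car M) = (l + δ) • c + (c' * z' + δ • c') := by
        have : δ • (1 : Car M) = δ • c + δ • c' := by rw [hc', ← smul_add]; simp
        rw [this, add_smul]; abel
      rw [e4]
      calc h = c * h + c' * h := e1
        _ ≤ _ := add_le_add e2 e3
    · have e1 : l * (G (c * f)).re ≤ (G (c * φ'' h)).re := by
        have := hG.mono (hcut hcc hc0 hφh)
        rwa [mul_smul_comm, map_rsmul, Complex.re_ofReal_mul] at this
      rw [lmul_apply, lmul_apply, hcp] at hbG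
      have e2 : (G c).re - η / (2 * (l + 1)) ≤ (G (c * f)).re := by
        have h3 := (Complex.abs_re_le_norm _).trans_lt hbG
        rw [Complex.sub_re] at h3
        have := (abs_lt.mp h3).1
        linarith
      have e3 : l * (η / (2 * (l + 1))) ≤ η / 2 := by
        rw [mul_div_assoc', div_le_div_iff₀ (by positivity) (by positivity)]
        nlinarith
      have e4 : (G (φ h)).re = (G (c * φ'' h)).re + (G (c' * φ' h)).re := by
        rw [hφe, map_add, Complex.add_re]
      have e5 : (G (l • c + c' * z')).re = l * (G c).re + (G (c' * z')).re := by
        rw [map_add, map_rsmul, Complex.add_re, Complex.re_ofReal_mul]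
      rw [e4, e5]
      nlinarith [mul_le_mul_of_nonneg_left e2 hl0]

lemma lemmaC {G σ : Car M →L[ℂ] ℂ} (hG : Pos G) (hGn : Nml G) (hσ : Pos σ)
    (hz : ∀ z, Cen z → σ z = G z) {h : Car M} (hh : IsSelfAdjoint h) {δ : ℝ} (hδ : 0 < δ) :
    ∃ φ : Car M →L[ℂ] Car M, IsE φ ∧ (σ h).re - δ ≤ (G (φ h)).re := by
  set g : ℝ := (G 1).re with hg
  have hg0 : 0 ≤ g := hG.re_nonneg zero_le_one
  set δ' : ℝ := δ / (2 * (g + 1)) with hδ'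
  have hδ'0 : 0 < δ' := by positivity
  obtain ⟨N, hN⟩ := exists_nat_ge (2 * ‖h‖ / δ')
  rw [div_le_iff₀ hδ'0] at hN
  obtain ⟨hb0, hb1⟩ := sa_bounds hh le_rfl
  obtain ⟨φ, hφ, z, hzc, hle, hGz⟩ := lemmaC_aux hδ'0 N (‖h‖ • 1 + h) hb0 (by
    have e : (‖h‖ • (1 : Car M) + h) ≤ (2 * ‖h‖) • 1 := by
      rw [← sub_nonneg, two_mul, add_smul]
      convert hb1 using 1; abel
    refine e.trans ?_
    rw [← sub_nonneg, ← sub_smul]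
    exact smul_nonneg (by linarith) zero_le_one) G hG hGn (δ / 2) (by positivity)
  refine ⟨φ, hφ, ?_⟩
  have h1 := hσ.mono hle
  rw [map_add, map_add, map_rsmul, map_rsmul, hz z hzc, hz 1 Cen.one, Complex.add_re, Complex.add_re,
    Complex.re_ofReal_mul, Complex.re_ofReal_mul] at h1
  have h2 : φ (‖h‖ • (1 : Car M) + h) = ‖h‖ • 1 + φ h := by
    rw [map_add, hφ.map_central (Cen.one.rsmul _)]
  rw [h2, map_add, map_rsmul, Complex.add_re, Complex.re_ofReal_mul] at hGz
  have h3 : δ' * g ≤ δ / 2 := by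
    rw [hδ', div_mul_eq_mul_div, div_le_div_iff₀ (by positivity) (by positivity)]
    nlinarith
  linarith

lemma lemmaB {G σ : Car M →L[ℂ] ℂ} (hG : Pos G) (hGn : Nml G) (hσ : Pos σ) (hσn : Nml σ)
    (hz : ∀ z, Cen z → σ z = G z) {ε : ℝ} (hε : 0 < ε) :
    ∃ φ : Car M →L[ℂ] Car M, IsE φ ∧ ‖σ - G.comp φ‖ < ε :=
  mem_closure_mix' hGn hσn hG.herm hσ.herm (fun T hT δ hδ => lemmaC hG hGn hσ hz hT hδ) ε hε

lemma lemmaA {D : Car M →L[ℂ] ℂ} (hDn : Nml D) (hDh : ∀ a, D (star a) = conj (D a))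
    (hz : ∀ z, Cen z → D z = 0) {ε : ℝ} (hε : 0 < ε) :
    ∃ φ : Car M →L[ℂ] Car M, IsE φ ∧ ‖D.comp φ‖ < ε := by
  obtain ⟨q, r, s, Dp, Dm, hqr, -, hp, hm, hpn, hmn, hpx, hmx, hD, -⟩ := jordan hDn hDh
  have key := mem_closure_mix' (ω := D) (ρ := 0) hDn Nml.zero hDh (fun a => by simp)
    (fun T hT δ hδ => by
      obtain ⟨φ, hφ, h⟩ := lemmaC (G := Dp) (σ := Dm) hp hpn hm (fun z hzc => by
        have := hD z
        rw [hz z hzc] at this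
        exact (sub_eq_zero.mp this.symm).symm) hT hδ
      obtain ⟨ψ, hψ, hψx⟩ := IsE.comb2 hφ IsE.id hqr
      refine ⟨ψ, hψ, ?_⟩
      have e : D (ψ T) = Dp (φ T) - Dm T := by
        rw [hψx, map_add, ← hpx, hmx, ContinuousLinearMap.id_apply]; ring
      rw [e, Complex.sub_re]
      have : ((0 : Car M →L[ℂ] ℂ) T).re = 0 := rfl
      rw [this]; linarith) ε hε
  obtain ⟨φ, hφ, h⟩ := key
  exact ⟨φ, hφ, by rwa [zero_sub, norm_neg] at h⟩

end LemmaC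

section RN
set_option linter.all false

lemma hb_factor {V W : Type u} [AddCommGroup V] [Module ℂ V] [NormedAddCommGroup W] [NormedSpace ℂ W]
    (L : V →ₗ[ℂ] W) (f : V →ₗ[ℂ] ℂ) (C : ℝ) (hC : 0 ≤ C) (h : ∀ v, ‖f v‖ ≤ C * ‖L v‖) :
    ∃ F : W →L[ℂ] ℂ, ‖F‖ ≤ C ∧ ∀ v, F (L v) = f v := by
  have hker : LinearMap.ker L ≤ LinearMap.ker f := by
    intro v hv
    rw [LinearMap.mem_ker] at hv ⊢
    have := h v
    rw [hv, norm_zero, mul_zero] at this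
    exact norm_le_zero_iff.mp this
  let f' : LinearMap.range L →ₗ[ℂ] ℂ :=
    ((LinearMap.ker L).liftQ f hker) ∘ₗ (L.quotKerEquivRange.symm : LinearMap.range L →ₗ[ℂ] _)
  have hf' : ∀ v, f' ⟨L v, LinearMap.mem_range_self L v⟩ = f v := by
    intro v
    have e : L.quotKerEquivRange.symm ⟨L v, LinearMap.mem_range_self L v⟩
        = (LinearMap.ker L).mkQ v := by
      rw [LinearEquiv.symm_apply_eq]
      rfl
    change (LinearMap.ker L).liftQ f hker (L.quotKerEquivRange.symm _) = _
    rw [e]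
    rfl
  let g : LinearMap.range L →L[ℂ] ℂ := f'.mkContinuous C (by
    rintro ⟨_, v, rfl⟩
    rw [hf']
    exact h v)
  obtain ⟨F, hF, hn⟩ := exists_extension_norm_eq (LinearMap.range L) g
  refine ⟨F, ?_, fun v => ?_⟩
  · rw [hn]; exact LinearMap.mkContinuous_norm_le _ hC _
  · rw [← hf' v]; exact hF ⟨L v, LinearMap.mem_range_self L v⟩

/-- `z ↦ μ(z ·)|Z`. -/
def Lz (μ : Car M →L[ℂ] ℂ) : Car (Zvn M) →ₗ[ℂ] (Car (Zvn M) →L[ℂ] ℂ) where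
  toFun z := (lmul μ (inc z)).comp inc
  map_add' z w := by
    ext y
    change μ (inc (z + w) * inc y) = μ (inc z * inc y) + μ (inc w * inc y)
    rw [map_add, add_mul, map_add]
  map_smul' c w := by
    ext y
    change μ (inc (c • w) * inc y) = c * μ (inc w * inc y)
    rw [map_smul, smul_mul_assoc, map_smul, smul_eq_mul]

lemma Lz_apply (μ : Car M →L[ℂ] ℂ) (z y : Car (Zvn M)) : Lz μ z y = μ (inc z * inc y) := rfl

lemma Lz_nml {μ : Car M →L[ℂ] ℂ} (hμ : Nml μ) (z : Car (Zvn M)) : Nml (Lz μ z) :=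
  (hμ.lmul (inc z)).inc

lemma rn_bound {μ σ : Car M →L[ℂ] ℂ} (hμ : Pos μ) (hσ : Pos σ)
    (hle : ∀ c, Cen c → 0 ≤ c → (σ c).re ≤ (μ c).re) (x : Car M) (z : Car (Zvn M)) :
    ‖σ (x * inc z)‖ ≤ ‖x‖ * ‖Lz μ z‖ := by
  refine le_of_forall_pos_le_add fun δ hδ => ?_
  have hm : 0 ≤ (μ 1).re := hμ.re_nonneg zero_le_one
  have hd : 0 < ‖x‖ * (μ 1).re + 1 := by positivity
  obtain ⟨b, c, hb0, hbc, hcc, hcn, hble, hf⟩ := exists_central_polar (inc_cen z) (div_pos hδ hd)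
  obtain ⟨c', rfl⟩ := exists_inc hcc
  have h1 := hf σ hσ x
  have h2 := hle b hbc hb0
  have h3 := hμ.mono hble
  rw [map_add, map_rsmul, Complex.add_re, Complex.re_ofReal_mul, hcc] at h3
  have h4 : (μ (inc z * inc c')).re ≤ ‖Lz μ z‖ := by
    refine (Complex.re_le_norm _).trans ?_
    rw [← Lz_apply]
    refine ((Lz μ z).le_opNorm c').trans ?_
    rw [← inc_norm]
    exact mul_le_of_le_one_right (norm_nonneg _) hcn
  have h5 : ‖x‖ * (δ / (‖x‖ * (μ 1).re + 1) * (μ 1).re) ≤ δ := by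
    have : ‖x‖ * (δ / (‖x‖ * (μ 1).re + 1) * (μ 1).re) =
      δ * ((‖x‖ * (μ 1).re) / (‖x‖ * (μ 1).re + 1)) := by ring
    rw [this]
    refine mul_le_of_le_one_right hδ.le ((div_le_one hd).mpr (by linarith))
  calc ‖σ (x * inc z)‖ ≤ ‖x‖ * (σ b).re := h1
    _ ≤ ‖x‖ * (‖Lz μ z‖ + δ / (‖x‖ * (μ 1).re + 1) * (μ 1).re) := by
        refine mul_le_mul_of_nonneg_left ?_ (norm_nonneg _)
        linarith
    _ ≤ ‖x‖ * ‖Lz μ z‖ + δ := by rw [mul_add]; linarith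

lemma rn {μ σ : Car M →L[ℂ] ℂ} (hμ : Pos μ) (hμn : Nml μ) (hσ : Pos σ)
    (hle : ∀ c, Cen c → 0 ≤ c → (σ c).re ≤ (μ c).re) (x : Car M) :
    ∃ T, Cen T ∧ ‖T‖ ≤ ‖x‖ ∧ ∀ z, Cen z → μ (T * z) = σ (x * z) := by
  let f : Car (Zvn M) →ₗ[ℂ] ℂ :=
    { toFun := fun z => σ (x * inc z)
      map_add' := fun z w => by rw [map_add, mul_add, map_add]
      map_smul' := fun c w => by
        rw [map_smul, mul_smul_comm, map_smul]; rfl }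
  obtain ⟨F, hF, hFL⟩ := hb_factor (Lz μ) f ‖x‖ (norm_nonneg _) (rn_bound hμ hσ hle x)
  obtain ⟨T, hT, hFT⟩ := exists_T F
  refine ⟨inc T, inc_cen T, by rw [inc_norm]; exact hT.trans hF, fun z hz => ?_⟩
  obtain ⟨z', rfl⟩ := exists_inc hz
  have h1 := hFT (Lz μ z') (Lz_nml hμn z')
  rw [hFL, Lz_apply, ← (inc_cen T _).eq] at h1
  exact h1.symm

/-- hermitian Radon-Nikodym derivative -/
lemma rn_sa {μ σ : Car M →L[ℂ] ℂ} (hμ : Pos μ) (hμn : Nml μ) (hσ : Pos σ)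
    (hle : ∀ c, Cen c → 0 ≤ c → (σ c).re ≤ (μ c).re) :
    ∃ T, Cen T ∧ IsSelfAdjoint T ∧ ‖T‖ ≤ 1 ∧ ∀ z, Cen z → μ (T * z) = σ z := by
  obtain ⟨T, hT, hTn, h⟩ := rn hμ hμn hσ hle 1
  have hn1 : ‖(1 : Car M)‖ ≤ 1 := norm_le_one_of zero_le_one le_rfl
  refine ⟨(1 / 2 : ℝ) • (T + star T), (hT.add hT.star).rsmul _,
    (IsSelfAdjoint.all (1 / 2 : ℝ)).smul (IsSelfAdjoint.add_star_self T), ?_, fun z hz => ?_⟩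
  · rw [norm_smul]
    have := norm_add_le T (star T)
    rw [norm_star] at this
    rw [Real.norm_of_nonneg (by norm_num)]
    linarith
  · have h1 := h z hz
    have h2 : μ (star T * z) = σ z := by
      have h3 := h (star z) hz.star
      have h4 : star T * z = star (T * star z) := by
        rw [star_mul, star_star, (hT.star z).eq]
      rw [h4, hμ.herm, h3, one_mul, hσ.herm, Complex.conj_conj]
    rw [one_mul] at h1
    rw [smul_mul_assoc, map_rsmul, add_mul, map_add, h1, h2]
    push_cast; ring

lemma support {μ : Car M →L[ℂ] ℂ} (hμ : Pos μ) (hμn : Nml μ) :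
    ∃ e, Cen e ∧ IsSelfAdjoint e ∧ e * e = e ∧ (∀ x, μ ((1 - e) * x) = 0) ∧
      ∀ z, Cen z → (∀ w, Cen w → μ (z * w) = 0) → e * z = 0 := by
  let Y : Set (Car M) := {y | ∃ n r, Cen n ∧ (∀ w, Cen w → μ (n * w) = 0) ∧ y = n * r}
  obtain ⟨f, hfc, hfs, hfp, hfY, happ⟩ := carrier Y (by
    rintro y ⟨n, r, hn, h, rfl⟩ r'
    exact ⟨n, r * r', hn, h, by rw [mul_assoc]⟩)
  have hY0 : ∀ y ∈ Y, μ (star y * y) = 0 := by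
    rintro y ⟨n, r, hn, h, rfl⟩
    have h1 := hμ.norm_central_mul_le (star_mul_self_nonneg n) (hn.star.mul hn) (star r * r)
    rw [(hn.star n).eq, h _ hn.star, Complex.zero_re, mul_zero] at h1
    have h2 : star (n * r) * (n * r) = n * star n * (star r * r) := by
      rw [star_mul]
      calc star r * star n * (n * r) = star r * (star n * n) * r := by simp only [mul_assoc]
        _ = (star n * n) * star r * r := by rw [((hn.star.mul hn) _).eq]
        _ = _ := by rw [(hn.star n).eq]; simp only [mul_assoc]
    rw [h2]
    exact norm_le_zero_iff.mp h1
  have hf0 : μ f = 0 := by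
    by_contra hne
    obtain ⟨n, b, hb, -, hlt⟩ := happ μ hμn ‖μ f‖ (norm_pos_iff.mpr hne)
    rw [map_sum, Finset.sum_eq_zero fun i _ => hY0 _ (hb i), zero_sub, norm_neg] at hlt
    exact lt_irrefl _ hlt
  refine ⟨1 - f, Cen.one.sub hfc, (IsSelfAdjoint.one _).sub hfs, ?_, fun x => ?_, fun z hz h => ?_⟩
  · rw [mul_sub, mul_one, sub_mul, one_mul, hfp]; abel
  · rw [sub_sub_cancel]
    have h1 := hμ.norm_central_mul_le (proj_nonneg hfs hfp) hfc x
    rw [hf0, Complex.zero_re, mul_zero] at h1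
    exact norm_le_zero_iff.mp h1
  · have := hfY z ⟨z, 1, hz, h, by rw [mul_one]⟩
    rw [sub_mul, one_mul, (hfc z).eq, this, sub_self]

lemma exists_Phi {μ σ : Car M →L[ℂ] ℂ} (hμ : Pos μ) (hμn : Nml μ) (hσ : Pos σ) (hσn : Nml σ)
    (hz : ∀ z, Cen z → σ z = μ z) :
    ∃ (e : Car M) (Φ : Car M →L[ℂ] Car M), Cen e ∧ IsSelfAdjoint e ∧ e * e = e ∧
      (∀ x, μ ((1 - e) * x) = 0) ∧ (∀ x, Cen (Φ x)) ∧ (∀ x, ‖Φ x‖ ≤ ‖x‖) ∧ Φ 1 = e ∧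
      (∀ x z, Cen z → Φ (z * x) = z * Φ x) ∧ (∀ x, e * Φ x = Φ x) ∧
      (∀ x z, Cen z → μ (Φ x * z) = σ (x * z)) ∧ ∀ g, Nml g → Nml (g.comp Φ) := by
  obtain ⟨e, hec, hes, hep, he0, hez⟩ := support hμ hμn
  have hen : ‖e‖ ≤ 1 := by
    refine norm_le_one_of (proj_nonneg hes hep) ?_
    have := proj_nonneg (c := 1 - e) ((IsSelfAdjoint.one _).sub hes)
      (by rw [mul_sub, mul_one, sub_mul, one_mul, hep]; abel)
    exact sub_nonneg.mp this
  have hμe : ∀ x, μ (e * x) = μ x := fun x => by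
    have := he0 x
    rw [sub_mul, one_mul, map_sub, sub_eq_zero] at this
    exact this.symm
  choose T hTc hTn hT using rn hμ hμn hσ (fun c hc _ => by rw [hz c hc])
  have hP : ∀ x z, Cen z → μ (e * T x * z) = σ (x * z) := fun x z hz => by
    rw [mul_assoc, hμe, hT x z hz]
  have huniq : ∀ x w, Cen w → e * w = w → (∀ z, Cen z → μ (w * z) = σ (x * z)) → e * T x = w := by
    intro x w hw hew h
    have := hez (T x - w) ((hTc x).sub hw) (fun z hz => by
      rw [sub_mul, map_sub, hT x z hz, h z hz, sub_self])
    rw [mul_sub, hew, sub_eq_zero] at this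
    exact this
  have hee : ∀ x, e * (e * x) = e * x := fun x => by rw [← mul_assoc, hep]
  let Φ : Car M →L[ℂ] Car M := LinearMap.mkContinuous
    { toFun := fun x => e * T x
      map_add' := fun x y => huniq _ _ ((hec.mul (hTc x)).add (hec.mul (hTc y)))
        (by rw [mul_add, hee, hee]) (fun z hz => by
          rw [add_mul, map_add, hP x z hz, hP y z hz, add_mul, map_add])
      map_smul' := fun c x => huniq _ _ ((hec.mul (hTc x)).smul c)
        (by rw [RingHom.id_apply, mul_smul_comm, hee]) (fun z hz => by
          rw [RingHom.id_apply, smul_mul_assoc, map_smul, hP x z hz, smul_mul_assoc, map_smul]) }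
    1 (fun x => by
      rw [one_mul]
      refine (norm_mul_le e (T x)).trans ?_
      calc ‖e‖ * ‖T x‖ ≤ 1 * ‖x‖ := mul_le_mul hen (hTn x) (norm_nonneg _) zero_le_one
        _ = ‖x‖ := one_mul _)
  have hΦ : ∀ x, Φ x = e * T x := fun x => rfl
  have hΦn : ∀ x, ‖Φ x‖ ≤ ‖x‖ := fun x => by
    rw [hΦ]
    refine (norm_mul_le e (T x)).trans ?_
    calc ‖e‖ * ‖T x‖ ≤ 1 * ‖x‖ := mul_le_mul hen (hTn x) (norm_nonneg _) zero_le_one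
      _ = ‖x‖ := one_mul _
  refine ⟨e, Φ, hec, hes, hep, he0, fun x => hec.mul (hTc x), hΦn, ?_, fun x z hzc => ?_, fun x => hee _,
    hP, fun g hg => ?_⟩
  · refine huniq 1 e hec hep fun z hzc => ?_
    rw [one_mul, hμe, hz z hzc]
  · refine huniq _ _ (hzc.mul (hec.mul (hTc x))) ?_ fun w hw => ?_
    · rw [← mul_assoc, ← (hzc e).eq, mul_assoc]
      change z * (e * (e * T x)) = z * (e * T x)
      rw [hee]
    · have : z * (e * T x) * w = e * T x * (z * w) := by
        rw [(hzc _).eq, mul_assoc]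
      change μ (z * (e * T x) * w) = _
      rw [this, hP x _ (hzc.mul hw), ← mul_assoc, ← (hzc x).eq]
  · -- normality
    have hcl : (lmul g e).comp inc ∈ closure (Set.range (Lz μ)) := by
      refine mem_closure_of_forall ?_ ?_ (hg.lmul e).inc ?_
      · rintro _ ⟨z, rfl⟩; exact Lz_nml hμn z
      · rintro _ ⟨z, rfl⟩ _ ⟨w, rfl⟩ t _ _
        exact ⟨(t : ℂ) • z + ((1 - t : ℝ) : ℂ) • w, by rw [map_add, map_smul, map_smul]⟩
      · intro S δ hδ
        by_cases h : ∀ w, Cen w → μ (inc S * w) = 0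
        · refine ⟨_, ⟨0, rfl⟩, ?_⟩
          have h1 : (lmul g e).comp inc S = 0 := by
            change g (e * inc S) = 0
            rw [hez _ (inc_cen S) h, map_zero]
          have h2 : Lz μ 0 S = 0 := by
            rw [Lz_apply, map_zero, zero_mul, map_zero]
          rw [h1, h2]; simp [hδ.le]
        · push Not at h
          obtain ⟨w, hw, hne⟩ := h
          obtain ⟨w', rfl⟩ := exists_inc hw
          refine ⟨_, ⟨(g (e * inc S) / μ (inc S * inc w')) • w', rfl⟩, ?_⟩
          have h2 : Lz μ ((g (e * inc S) / μ (inc S * inc w')) • w') S = g (e * inc S) := by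
            rw [Lz_apply, map_smul, smul_mul_assoc, map_smul, smul_eq_mul, ← (inc_cen S (inc w')).eq,
              div_mul_cancel₀ _ hne]
          rw [h2]
          change (g (e * inc S)).re - δ ≤ _
          linarith
    have : g.comp Φ ∈ closure {g : Car M →L[ℂ] ℂ | Nml g} := by
      rw [Metric.mem_closure_iff] at hcl ⊢
      intro ε hε
      obtain ⟨_, ⟨c, rfl⟩, hc⟩ := hcl (ε / 2) (by positivity)
      refine ⟨lmul σ (inc c), hσn.lmul _, ?_⟩
      rw [dist_eq_norm] at hc ⊢
      refine lt_of_le_of_lt (ContinuousLinearMap.opNorm_le_bound _ (M := ε / 2) (by positivity)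
        fun x => ?_) (by linarith : ε / 2 < ε)
      obtain ⟨y, hy⟩ := exists_inc (hec.mul (hTc x))
      have h1 : (g.comp Φ - lmul σ (inc c)) x = ((lmul g e).comp inc - Lz μ c) y := by
        change g (e * T x) - σ (inc c * x) = g (e * inc y) - μ (inc c * inc y)
        rw [hy, hee, (inc_cen c (e * T x)).eq, hP x _ (inc_cen c), (inc_cen c x).eq]
      rw [h1]
      refine (ContinuousLinearMap.le_opNorm _ _).trans ?_
      rw [← inc_norm, hy]
      exact mul_le_mul hc.le (hΦn x) (norm_nonneg _) (by positivity)
    exact isClosed_nml.closure_subset this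

end RN

section Theta
set_option linter.all false

lemma Pos.norm_le {G : Car M →L[ℂ] ℂ} (hG : Pos G) : ‖G‖ ≤ (G 1).re := by
  refine ContinuousLinearMap.opNorm_le_bound _ (hG.re_nonneg zero_le_one) fun x => ?_
  have := hG.norm_central_mul_le zero_le_one Cen.one x
  rw [one_mul] at this
  linarith

lemma Pos.sum {ι : Type*} (s : Finset ι) {G : ι → (Car M →L[ℂ] ℂ)} (h : ∀ i ∈ s, Pos (G i)) :
    Pos (∑ i ∈ s, G i) := fun a => by
  rw [funsum_apply]
  exact Finset.sum_nonneg fun i hi => h i hi a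

lemma lemmaA_fin {ι : Type*} (s : Finset ι) {D : ι → (Car M →L[ℂ] ℂ)} (hn : ∀ i, Nml (D i))
    (hh : ∀ i a, D i (star a) = conj (D i a)) (hz : ∀ i z, Cen z → D i z = 0) {ε : ℝ} (hε : 0 < ε) :
    ∃ φ : Car M →L[ℂ] Car M, IsE φ ∧ ∀ i ∈ s, ‖(D i).comp φ‖ < ε := by
  classical
  induction s using Finset.induction_on with
  | empty => exact ⟨_, IsE.id, fun i hi => absurd hi (Finset.notMem_empty i)⟩
  | insert k s hk ih =>
    obtain ⟨φ, hφ, h⟩ := ih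
    obtain ⟨φ', hφ', h'⟩ := lemmaA (D := (D k).comp φ) (hφ.nml (hn k))
      (fun a => by
        rw [ContinuousLinearMap.comp_apply, ContinuousLinearMap.comp_apply, hφ.map_star, hh])
      (fun z hzc => by rw [ContinuousLinearMap.comp_apply, hφ.map_central hzc, hz k z hzc]) hε
    refine ⟨φ.comp φ', hφ.comp hφ', fun i hi => ?_⟩
    rcases Finset.mem_insert.mp hi with rfl | hi
    · exact h'
    · exact lt_of_le_of_lt (hφ'.comp_norm_le ((D i).comp φ)) (h i hi)

/-- norm approximation of finitely many normal functionals -/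
def Appr (θ : Car M →L[ℂ] Car M) : Prop :=
  ∀ (ι : Type) [Fintype ι] (g : ι → (Car M →L[ℂ] ℂ)), (∀ i, Nml (g i)) → ∀ ε : ℝ, 0 < ε →
    ∃ φ : Car M →L[ℂ] Car M, IsE φ ∧ ∀ i, ‖(g i).comp θ - (g i).comp φ‖ < ε

lemma appr_of_pos {θ : Car M →L[ℂ] Car M}
    (h : ∀ (ι : Type) [Fintype ι] (g : ι → (Car M →L[ℂ] ℂ)), (∀ i, Nml (g i)) → (∀ i, Pos (g i)) →
      ∀ ε : ℝ, 0 < ε →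
      ∃ φ : Car M →L[ℂ] Car M, IsE φ ∧ ∀ i, ‖(g i).comp θ - (g i).comp φ‖ < ε) : Appr θ := by
  intro ι _ g hg ε hε
  choose G c hG hgc using fun i => (hg i).polar
  set C : ℝ := ∑ i, ∑ k, ‖c i k‖ with hC
  have hC0 : 0 ≤ C := Finset.sum_nonneg fun i _ => Finset.sum_nonneg fun k _ => norm_nonneg _
  obtain ⟨φ, hφ, hle⟩ := h (ι × Fin 4) (fun p => G p.1 p.2) (fun p => (hG p.1 p.2).2)
    (fun p => (hG p.1 p.2).1) (ε / (C + 1)) (by positivity)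
  refine ⟨φ, hφ, fun i => ?_⟩
  have e : (g i).comp θ - (g i).comp φ = ∑ k, c i k • ((G i k).comp θ - (G i k).comp φ) := by
    ext x
    rw [funsum_apply]
    change g i (θ x) - g i (φ x) = _
    rw [hgc i, funsum_apply, funsum_apply, ← Finset.sum_sub_distrib]
    refine Finset.sum_congr rfl fun k _ => ?_
    change c i k * G i k (θ x) - c i k * G i k (φ x) = c i k * (G i k (θ x) - G i k (φ x))
    ring
  rw [e]
  calc ‖∑ k, c i k • ((G i k).comp θ - (G i k).comp φ)‖
      ≤ ∑ k, ‖c i k‖ * (ε / (C + 1)) := by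
        refine (norm_sum_le _ _).trans (Finset.sum_le_sum fun k _ => ?_)
        refine (norm_smul_le (c i k) ((G i k).comp θ - (G i k).comp φ)).trans ?_
        exact mul_le_mul_of_nonneg_left (hle (i, k)).le (norm_nonneg _)
    _ = (∑ k, ‖c i k‖) * (ε / (C + 1)) := by rw [Finset.sum_mul]
    _ ≤ C * (ε / (C + 1)) := by
        refine mul_le_mul_of_nonneg_right ?_ (by positivity)
        exact Finset.single_le_sum (f := fun i => ∑ k, ‖c i k‖)
          (fun i _ => Finset.sum_nonneg fun k _ => norm_nonneg _) (Finset.mem_univ i)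
    _ < ε := by
        have : C * (ε / (C + 1)) = ε * (C / (C + 1)) := by ring
        rw [this]
        exact mul_lt_of_lt_one_right hε ((div_lt_one (by linarith)).mpr (by linarith))

lemma appr_theta {e : Car M} {Φ θ : Car M →L[ℂ] Car M} (hec : Cen e) (hes : IsSelfAdjoint e)
    (hep : e * e = e) (hΦc : ∀ x, Cen (Φ x)) (hΦn : ∀ x, ‖Φ x‖ ≤ ‖x‖) (hΦ1 : Φ 1 = e)
    (hΦz : ∀ x z, Cen z → Φ (z * x) = z * Φ x) (hΦe : ∀ x, e * Φ x = Φ x)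
    (hΦg : ∀ g : Car M →L[ℂ] ℂ, Nml g → Nml (g.comp Φ)) (hθ : ∀ x, θ x = Φ x + (1 - e) * x) :
    Appr θ := by
  refine appr_of_pos fun ι _ g hg hgp ε hε => ?_
  have he0 := proj_nonneg hes hep
  set G' : ι → (Car M →L[ℂ] ℂ) := fun i => lmul (g i) e with hG'
  have hG'p : ∀ i, Pos (G' i) := fun i => lmul_pos (hgp i) hec he0
  have hG'n : ∀ i, Nml (G' i) := fun i => (hg i).lmul e
  set G : Car M →L[ℂ] ℂ := ∑ i, G' i with hG
  have hGp : Pos G := Pos.sum _ fun i _ => hG'p i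
  have hGn : Nml G := Nml.sum _ fun i _ => hG'n i
  have hGe : ∀ x, G (e * x) = G x := fun x => by
    rw [hG, funsum_apply, funsum_apply]
    refine Finset.sum_congr rfl fun i _ => ?_
    change g i (e * (e * x)) = g i (e * x)
    rw [← mul_assoc, hep]
  choose c hcc hcs hcn hc using fun i => rn_sa hGp hGn (hG'p i) (fun a ha h0 => by
    rw [hG, funsum_apply, Complex.re_sum]
    exact Finset.single_le_sum (f := fun i => (G' i a).re)
      (fun j _ => (hG'p j).re_nonneg h0) (Finset.mem_univ i))
  have hcomm : ∀ i x, G (c i * x) = G (x * c i) := fun i x => by rw [(hcc i x).eq]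
  obtain ⟨φ, hφ, hφD⟩ := lemmaA_fin Finset.univ (D := fun i => G' i - lmul G (c i))
    (fun i => (hG'n i).sub (hGn.lmul _)) (fun i a => by
      change G' i (star a) - G (c i * star a) = conj (G' i a - G (c i * a))
      have : c i * star a = star (c i * a) := by
        rw [star_mul, (hcs i).star_eq, (hcc i _).eq]
      rw [this, (hG'p i).herm, hGp.herm, map_sub])
    (fun i z hz => by
      change G' i z - G (c i * z) = 0
      rw [hc i z hz, sub_self]) (half_pos hε)
  have hPp : Pos (G.comp Φ) := by
    refine pos_of_norm_le (N := (G 1).re) ?_ ?_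
    · rw [hGp.real (IsSelfAdjoint.one _), ContinuousLinearMap.comp_apply, hΦ1, ← hGe 1, mul_one]
    · refine ContinuousLinearMap.opNorm_le_bound _ (hGp.re_nonneg zero_le_one) fun x => ?_
      exact (G.le_opNorm _).trans (mul_le_mul hGp.norm_le (hΦn x) (norm_nonneg _)
        (hGp.re_nonneg zero_le_one))
  obtain ⟨φ₂, hφ₂, hlt⟩ := lemmaB (G := G.comp φ) (σ := G.comp Φ) (hφ.pos hGp) (hφ.nml hGn) hPp
    (hΦg G hGn) (fun z hz => by
      rw [ContinuousLinearMap.comp_apply, ContinuousLinearMap.comp_apply, hφ.map_central hz]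
      have := hΦz 1 z hz
      rw [mul_one, hΦ1, (hz e).eq] at this
      rw [this, hGe]) (half_pos hε)
  have h3 : IsE (φ.comp φ₂) := hφ.comp hφ₂
  obtain ⟨ψ, hψ, hψx⟩ := h3.cut IsE.id hec hes hep
  refine ⟨ψ, hψ, fun i => ?_⟩
  have e1 : (g i).comp θ - (g i).comp ψ =
      ((G.comp Φ - (G.comp φ).comp φ₂).comp (ContinuousLinearMap.mul ℂ (Car M) (c i)))
        - ((G' i - lmul G (c i)).comp φ).comp φ₂ := by
    ext x
    change g i (θ x) - g i (ψ x) = (G (Φ (c i * x)) - G (φ (φ₂ (c i * x))))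
      - (g i (e * φ (φ₂ x)) - G (c i * φ (φ₂ x)))
    rw [hΦz x _ (hcc i), hφ₂.central (hcc i), hφ.central (hcc i), hθ, hψx]
    have h5 : G (c i * Φ x) = g i (Φ x) := by
      rw [hc i _ (hΦc x)]
      change g i (e * Φ x) = _
      rw [hΦe]
    rw [h5, map_add, map_add]
    change g i (Φ x) + g i ((1 - e) * x) - (g i (e * φ (φ₂ x)) + g i ((1 - e) * x)) = _
    ring
  rw [e1]
  refine lt_of_le_of_lt (norm_sub_le (E := Car M →L[ℂ] ℂ) _ _) ?_
  have h6 : ‖(G.comp Φ - (G.comp φ).comp φ₂).comp (ContinuousLinearMap.mul ℂ (Car M) (c i))‖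
      ≤ ‖G.comp Φ - (G.comp φ).comp φ₂‖ := by
    refine ContinuousLinearMap.opNorm_le_bound _ (norm_nonneg _) fun x => ?_
    refine ((G.comp Φ - (G.comp φ).comp φ₂).le_opNorm (c i * x)).trans ?_
    exact mul_le_mul_of_nonneg_left ((norm_mul_le (c i) x).trans
      (mul_le_of_le_one_left (norm_nonneg x) (hcn i))) (norm_nonneg _)
  have h7 := lt_of_le_of_lt (hφ₂.comp_norm_le ((G' i - lmul G (c i)).comp φ))
    (hφD i (Finset.mem_univ i))
  linarith

lemma theta {μ σ : Car M →L[ℂ] ℂ} (hμ : Pos μ) (hμn : Nml μ) (hσ : Pos σ) (hσn : Nml σ)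
    (hz : ∀ z, Cen z → σ z = μ z) :
    ∃ θ : Car M →L[ℂ] Car M, Appr θ ∧ (∀ g, Nml g → Nml (g.comp θ)) ∧ θ 1 = 1 ∧
      ∀ x, μ (θ x) = σ x := by
  obtain ⟨e, Φ, hec, hes, hep, he0, hΦc, hΦn, hΦ1, hΦz, hΦe, hΦμ, hΦg⟩ := exists_Phi hμ hμn hσ hσn hz
  let θ : Car M →L[ℂ] Car M := Φ + ContinuousLinearMap.mul ℂ (Car M) (1 - e)
  have hθ : ∀ x, θ x = Φ x + (1 - e) * x := fun x => rfl
  refine ⟨θ, appr_theta hec hes hep hΦc hΦn hΦ1 hΦz hΦe hΦg hθ, fun g hg => ?_, ?_, fun x => ?_⟩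
  · have : g.comp θ = g.comp Φ + lmul g (1 - e) := by
      ext x
      change g (θ x) = g (Φ x) + g ((1 - e) * x)
      rw [hθ, map_add]
    rw [this]
    exact (hΦg g hg).add (hg.lmul _)
  · rw [hθ, hΦ1, mul_one]; abel
  · have := hΦμ x 1 Cen.one
    rw [mul_one, mul_one] at this
    rw [hθ, map_add, he0, add_zero, this]

end Theta

section Main
set_option linter.all false

lemma appr_comb {θ₁ θ₂ : Car M →L[ℂ] Car M} (h₁ : Appr θ₁) (h₂ : Appr θ₂) {q r : Car M}
    (hqr : star q * q + star r * r = 1) : Appr ((cj q).comp θ₁ + (cj r).comp θ₂) := by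
  intro ι _ g hg ε hε
  obtain ⟨φ₁, hφ₁, hl₁⟩ := h₁ ι (fun i => sand (g i) (star q) q) (fun i => (hg i).sand _ _)
    (ε / 2) (half_pos hε)
  obtain ⟨φ₂, hφ₂, hl₂⟩ := h₂ ι (fun i => sand (g i) (star r) r) (fun i => (hg i).sand _ _)
    (ε / 2) (half_pos hε)
  obtain ⟨φ, hφ, hx⟩ := hφ₁.comb2 hφ₂ hqr
  refine ⟨φ, hφ, fun i => ?_⟩
  have e : (g i).comp ((cj q).comp θ₁ + (cj r).comp θ₂) - (g i).comp φ =
      ((sand (g i) (star q) q).comp θ₁ - (sand (g i) (star q) q).comp φ₁) +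
      ((sand (g i) (star r) r).comp θ₂ - (sand (g i) (star r) r).comp φ₂) := by
    ext x
    change g i (cj q (θ₁ x) + cj r (θ₂ x)) - g i (φ x) =
      (sand (g i) (star q) q (θ₁ x) - sand (g i) (star q) q (φ₁ x)) +
      (sand (g i) (star r) r (θ₂ x) - sand (g i) (star r) r (φ₂ x))
    rw [hx, cj_apply, cj_apply, map_add, map_add]
    simp only [sand_apply]
    ring
  rw [e]
  refine lt_of_le_of_lt (norm_add_le (E := Car M →L[ℂ] ℂ) _ _) ?_
  have a1 := hl₁ i
  have a2 := hl₂ i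
  linarith

lemma main_constr {ω ρ : Car M →L[ℂ] ℂ} (hω : Nml ω) (hρ : Nml ρ)
    (hωh : ∀ a, ω (star a) = conj (ω a)) (hρh : ∀ a, ρ (star a) = conj (ρ a))
    (hz : ∀ z, Cen z → ρ z = ω z)
    (hle : ∀ c, Cen c → 0 ≤ c → ∀ C : ℝ, (∀ x, ‖x‖ ≤ 1 → ‖ω (c * x)‖ ≤ C) →
      ∀ x, ‖x‖ ≤ 1 → ‖ρ (c * x)‖ ≤ C) :
    ∃ ψ : Car M →L[ℂ] Car M, Appr ψ ∧ (∀ g, Nml g → Nml (g.comp ψ)) ∧ ψ 1 = 1 ∧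
      ω.comp ψ = ρ := by
  obtain ⟨q, r, s, ωp, ωm, hqr, -, hp, hm, hpn, hmn, hωp, hωm, hωd, -⟩ := jordan hω hωh
  obtain ⟨-, -, t, ρp, ρm, -, ht, hp', hm', hpn', hmn', -, -, hρd, hρt⟩ := jordan hρ hρh
  have key : ∀ c, Cen c → 0 ≤ c → (ρp c).re + (ρm c).re ≤ (ωp c).re + (ωm c).re := by
    intro c hc h0
    have h1 := hle c hc h0 ((ωp c).re + (ωm c).re) (fun x hx => by
      rw [hωd]
      refine (norm_sub_le _ _).trans ?_
      have a1 := hp.norm_central_mul_le h0 hc x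
      have a2 := hm.norm_central_mul_le h0 hc x
      have b1 := mul_le_of_le_one_left (hp.re_nonneg h0) hx
      have b2 := mul_le_of_le_one_left (hm.re_nonneg h0) hx
      linarith) t ht
    rw [hρt] at h1
    have h2 := Complex.re_le_norm (ρp c + ρm c)
    rw [Complex.add_re] at h2
    linarith
  have keyp : ∀ c, Cen c → 0 ≤ c → (ρp c).re ≤ (ωp c).re := by
    intro c hc h0
    have h1 := key c hc h0
    have h2 := congrArg Complex.re (hz c hc)
    rw [hρd, hωd, Complex.sub_re, Complex.sub_re] at h2
    linarith
  obtain ⟨k, hkc, hks, hkn, hk⟩ := rn_sa hp hpn hp' keyp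
  have hk1 : 0 ≤ 1 - k := by
    have := (sa_bounds hks hkn).2
    rwa [one_smul] at this
  set τ : Car M →L[ℂ] ℂ := lmul ωp (1 - k) with hτ
  have hτp : Pos τ := lmul_pos hp (Cen.one.sub hkc) hk1
  have hτn : Nml τ := hpn.lmul _
  have hτz : ∀ z, Cen z → τ z = ωp z - ρp z := fun z hzc => by
    rw [hτ, lmul_apply, sub_mul, one_mul, map_sub, hk z hzc]
  have padd : ∀ {f g : Car M →L[ℂ] ℂ}, Pos f → Pos g → Pos (f + g) := fun hf hg a =>
    add_nonneg (hf a) (hg a)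
  obtain ⟨θ₁, ha₁, hn₁, ho₁, hx₁⟩ := theta hp hpn (padd hp' hτp) (hpn'.add hτn) (fun z hzc => by
    rw [ContinuousLinearMap.add_apply, hτz z hzc]; ring)
  obtain ⟨θ₂, ha₂, hn₂, ho₂, hx₂⟩ := theta hm hmn (padd hm' hτp) (hmn'.add hτn) (fun z hzc => by
    have := hz z hzc
    rw [hρd, hωd] at this
    rw [ContinuousLinearMap.add_apply, hτz z hzc]
    linear_combination -this)
  refine ⟨(cj q).comp θ₁ + (cj r).comp θ₂, appr_comb ha₁ ha₂ hqr, fun g hg => ?_, ?_, ?_⟩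
  · have : g.comp ((cj q).comp θ₁ + (cj r).comp θ₂) =
        (sand g (star q) q).comp θ₁ + (sand g (star r) r).comp θ₂ := by
      ext x
      change g (cj q (θ₁ x) + cj r (θ₂ x)) = sand g (star q) q (θ₁ x) + sand g (star r) r (θ₂ x)
      rw [cj_apply, cj_apply, map_add]
      simp only [sand_apply]
    rw [this]
    exact (hn₁ _ (hg.sand _ _)).add (hn₂ _ (hg.sand _ _))
  · change cj q (θ₁ 1) + cj r (θ₂ 1) = 1
    rw [ho₁, ho₂, cj_apply, cj_apply, mul_one, mul_one, hqr]
  · ext x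
    change ω (cj q (θ₁ x) + cj r (θ₂ x)) = ρ x
    have e1 := hωp (θ₁ x)
    have e2 := hωm (θ₂ x)
    rw [map_add, cj_apply, cj_apply, ← e1, hρd]
    rw [hx₁, ContinuousLinearMap.add_apply]
    rw [hx₂, ContinuousLinearMap.add_apply] at e2
    linear_combination e2

lemma inner_op_star (x y : Car M) (ξ η : H) : ⟪ξ, op (star x * y) η⟫ = ⟪op x ξ, op y η⟫ := by
  have h1 : op (star x * y) = star (op x) * op y := by rw [map_mul, map_star]
  rw [h1]
  exact ContinuousLinearMap.adjoint_inner_right (op x) ξ (op y η)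

lemma IsE.cp {φ : Car M →L[ℂ] Car M} (h : IsE φ) (n : ℕ) (a : Fin n → Car M) (v : Fin n → H) :
    0 ≤ ∑ i, ∑ j, ⟪v i, op (φ (star (a i) * a j)) (v j)⟫ := by
  obtain ⟨m, b, hb1, hb⟩ := h
  have e : ∑ i, ∑ j, ⟪v i, op (φ (star (a i) * a j)) (v j)⟫ =
      ∑ k, ⟪∑ i, op (a i) (op (b k) (v i)), ∑ j, op (a j) (op (b k) (v j))⟫ := by
    have h1 : ∀ i j, ⟪v i, op (φ (star (a i) * a j)) (v j)⟫ =
        ∑ k, ⟪op (a i) (op (b k) (v i)), op (a j) (op (b k) (v j))⟫ := by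
      intro i j
      rw [hb, sum_inner_star]
      refine Finset.sum_congr rfl fun k _ => ?_
      exact inner_op_star _ _ _ _
    simp only [h1, sum_inner, inner_sum]
    rw [Finset.sum_congr rfl fun i _ => Finset.sum_comm, Finset.sum_comm]
    exact Finset.sum_congr rfl fun k _ => Finset.sum_comm
  rw [e]
  refine Finset.sum_nonneg fun k _ => ?_
  refine Complex.nonneg_iff.mpr ⟨inner_self_nonneg (𝕜 := ℂ), (inner_self_im (𝕜 := ℂ) _).symm⟩

lemma Appr.cp {ψ : Car M →L[ℂ] Car M} (h : Appr ψ) (n : ℕ) (a : Fin n → Car M) (v : Fin n → H) :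
    0 ≤ ∑ i, ∑ j, ⟪v i, op (ψ (star (a i) * a j)) (v j)⟫ := by
  set S : (Car M →L[ℂ] Car M) → ℂ := fun φ => ∑ i, ∑ j, ⟪v i, op (φ (star (a i) * a j)) (v j)⟫ with hS
  set C : ℝ := ∑ i, ∑ j, ‖star (a i) * a j‖ with hC
  have hC0 : 0 ≤ C := Finset.sum_nonneg fun i _ => Finset.sum_nonneg fun k _ => norm_nonneg _
  have hcl : S ψ ∈ closure {w : ℂ | 0 ≤ w} := by
    rw [Metric.mem_closure_iff]
    intro ε hε
    obtain ⟨φ, hφ, hl⟩ := h (Fin n × Fin n) (fun p => vecF M (v p.1) (v p.2))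
      (fun p => isNormal_vecF _ _) (ε / (C + 1)) (by positivity)
    refine ⟨S φ, hφ.cp n a v, ?_⟩
    rw [dist_eq_norm]
    have e : S ψ - S φ = ∑ i, ∑ j, ((vecF M (v i) (v j)).comp ψ - (vecF M (v i) (v j)).comp φ)
        (star (a i) * a j) := by
      rw [hS]
      simp only [← Finset.sum_sub_distrib]
      rfl
    rw [e]
    calc _ ≤ ∑ i, ∑ j, (ε / (C + 1)) * ‖star (a i) * a j‖ := by
          refine (norm_sum_le _ _).trans (Finset.sum_le_sum fun i _ => ?_)
          refine (norm_sum_le _ _).trans (Finset.sum_le_sum fun j _ => ?_)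
          refine (ContinuousLinearMap.le_opNorm _ _).trans ?_
          exact mul_le_mul_of_nonneg_right (hl (i, j)).le (norm_nonneg _)
      _ = ε * (C / (C + 1)) := by
          simp only [← Finset.mul_sum]
          rw [← hC]; ring
      _ < ε := mul_lt_of_lt_one_right hε ((div_lt_one (by linarith)).mpr (by linarith))
  have hc : IsClosed {w : ℂ | 0 ≤ w} := isClosed_Ici
  exact hc.closure_subset hcl

lemma Appr.pw {ψ : Car M →L[ℂ] Car M} (h : Appr ψ) (ε : ℝ) (hε : 0 < ε) (n : ℕ) (x : Fin n → Car M)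
    (g : Fin n → (Car M →L[ℂ] ℂ)) (hg : ∀ i, Nml (g i)) :
    ∃ φ, IsE φ ∧ ∀ i j, ‖g i (ψ (x j)) - g i (φ (x j))‖ < ε := by
  set C : ℝ := ∑ j, ‖x j‖ with hC
  have hC0 : 0 ≤ C := Finset.sum_nonneg fun i _ => norm_nonneg _
  obtain ⟨φ, hφ, hl⟩ := h (Fin n) g hg (ε / (C + 1)) (by positivity)
  refine ⟨φ, hφ, fun i j => ?_⟩
  have h1 := ((g i).comp ψ - (g i).comp φ).le_opNorm (x j)
  have h2 : ‖x j‖ ≤ C := Finset.single_le_sum (f := fun j => ‖x j‖) (fun i _ => norm_nonneg _)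
    (Finset.mem_univ j)
  change ‖g i (ψ (x j)) - g i (φ (x j))‖ ≤ _ at h1
  refine lt_of_le_of_lt h1 ?_
  calc _ ≤ (ε / (C + 1)) * C := mul_le_mul (hl i).le h2 (norm_nonneg _) (by positivity)
    _ = ε * (C / (C + 1)) := by ring
    _ < ε := mul_lt_of_lt_one_right hε ((div_lt_one (by linarith)).mpr (by linarith))

lemma cen_of_center {z : ↥M} (hz : z ∈ Set.center ↥M) : Cen (M := M) (z : Car M) := fun x =>
  (Semigroup.mem_center_iff.mp hz x).symm

lemma center_of_cen {z : Car M} (hz : Cen z) : (z : ↥M) ∈ Set.center ↥M :=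
  Semigroup.mem_center_iff.mpr fun x => ((hz x).eq).symm

lemma bdd_mulNorm (ω : ↥M →L[ℂ] ℂ) (c : ↥M) :
    BddAbove {r : ℝ | ∃ x : ↥M, ‖x‖ ≤ 1 ∧ r = ‖ω (c * x)‖} := by
  refine ⟨‖ω‖ * ‖c‖, ?_⟩
  rintro r ⟨x, hx, rfl⟩
  refine (ω.le_opNorm _).trans (mul_le_mul_of_nonneg_left ?_ (norm_nonneg _))
  exact (norm_mul_le c x).trans (mul_le_of_le_one_right (norm_nonneg _) hx)

lemma le_mulNorm (ω : ↥M →L[ℂ] ℂ) (c : ↥M) {x : ↥M} (hx : ‖x‖ ≤ 1) : ‖ω (c * x)‖ ≤ mulNorm ω c :=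
  le_csSup (bdd_mulNorm ω c) ⟨x, hx, rfl⟩

lemma mulNorm_le (ω : ↥M →L[ℂ] ℂ) (c : ↥M) {C : ℝ} (h : ∀ x : ↥M, ‖x‖ ≤ 1 → ‖ω (c * x)‖ ≤ C) :
    mulNorm ω c ≤ C :=
  csSup_le ⟨_, 0, by simp, rfl⟩ (by rintro r ⟨x, hx, rfl⟩; exact h x hx)

lemma exists_main (ω ρ : ↥M →L[ℂ] ℂ) (hωh : IsHermitianFunctional ω) (hρh : IsHermitianFunctional ρ)
    (hωn : IsNormalFunctional ω) (hρn : IsNormalFunctional ρ)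
    (h : (∀ z ∈ Set.center ↥M, ρ z = ω z) ∧
        ∀ c ∈ Set.center ↥M, IsPositiveElem c → mulNorm ρ c ≤ mulNorm ω c) :
    ∃ ψ : Car M →L[ℂ] Car M, Appr ψ ∧ (∀ g, Nml g → Nml (g.comp ψ)) ∧ ψ 1 = 1 ∧
      ContinuousLinearMap.comp (show Car M →L[ℂ] ℂ from ω) ψ = ρ := by
  refine main_constr (M := M) (ω := ω) (ρ := ρ) hωn hρn hωh hρh
    (fun z hz => h.1 z (center_of_cen hz)) fun c hc h0 C hC x hx => ?_
  have hp : ∃ b : Car M, c = star b * b := CStarAlgebra.nonneg_iff_eq_star_mul_self.mp h0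
  have h1 := h.2 c (center_of_cen hc) hp
  exact (le_mulNorm (M := M) ρ c hx).trans (h1.trans (mulNorm_le (M := M) ω c hC))

lemma easy_aux {ω : Car M →L[ℂ] ℂ} {ψ : Car M →L[ℂ] Car M}
    (app : ∀ (x : Car M) (ε : ℝ), 0 < ε → ∃ φ : Car M →L[ℂ] Car M, IsE φ ∧
        ‖ω (ψ x) - ω (φ x)‖ < ε) :
    (∀ z, Cen z → ω (ψ z) = ω z) ∧ ∀ c, Cen c → ∀ C : ℝ, (∀ x, ‖x‖ ≤ 1 → ‖ω (c * x)‖ ≤ C) →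
      ∀ x, ‖x‖ ≤ 1 → ‖ω (ψ (c * x))‖ ≤ C := by
  refine ⟨fun z hz => ?_, fun c hc C hC x hx => ?_⟩
  · refine eq_of_sub_eq_zero (norm_le_zero_iff.mp (le_of_forall_pos_le_add fun ε hε => ?_))
    obtain ⟨φ, hφ, h⟩ := app z ε hε
    rw [hφ.map_central hz] at h
    rw [zero_add]
    exact h.le
  · refine le_of_forall_pos_le_add fun ε hε => ?_
    obtain ⟨φ, hφ, h⟩ := app (c * x) ε hε
    rw [hφ.central hc] at h
    have h1 := hC (φ x) ((hφ.norm_le x).trans hx)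
    have h3 := norm_le_norm_add_norm_sub' (ω (ψ (c * x))) (ω (c * φ x))
    linarith

end Main

/-- **Theorem.** For normal hermitian functionals `ω`, `ρ` on a von Neumann
algebra `M` with center `Z`: there is a normal unital completely positive map
`ψ` in the point-weak* closure of `E(M)` with `ψ 1 = 1` and `ω ∘ ψ = ρ` iff
`ρ|Z = ω|Z` and `‖cρ‖ ≤ ‖cω‖` for all positive central `c`. Under this
condition `ρ` lies in the norm closure of `ω ∘ E(M)`. -/
theorem normal_hermitian_transfer_iff
    (ω ρ : ↥M →L[ℂ] ℂ) (hωh : IsHermitianFunctional ω) (hρh : IsHermitianFunctional ρ)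
    (hωn : IsNormalFunctional ω) (hρn : IsNormalFunctional ρ) :
    ((∃ ψ : ↥M →L[ℂ] ↥M, IsNormalMap ψ ∧ IsCompletelyPositiveMap ψ ∧ ψ 1 = 1 ∧
        InPointWeakStarClosure {φ : ↥M →L[ℂ] ↥M | IsElementaryUCP φ} ψ ∧
        ω.comp ψ = ρ) ↔
      ((∀ z ∈ Set.center ↥M, ρ z = ω z) ∧
        ∀ c ∈ Set.center ↥M, IsPositiveElem c → mulNorm ρ c ≤ mulNorm ω c)) ∧
    (((∀ z ∈ Set.center ↥M, ρ z = ω z) ∧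
        ∀ c ∈ Set.center ↥M, IsPositiveElem c → mulNorm ρ c ≤ mulNorm ω c) →
      ρ ∈ closure (mixSet ω)) := by
  have clo : ((∀ z ∈ Set.center ↥M, ρ z = ω z) ∧
        ∀ c ∈ Set.center ↥M, IsPositiveElem c → mulNorm ρ c ≤ mulNorm ω c) →
      ρ ∈ closure (mixSet ω) := by
    intro h
    obtain ⟨ψ, ha, -, -, he⟩ := exists_main ω ρ hωh hρh hωn hρn h
    rw [Metric.mem_closure_iff]
    intro ε hε
    obtain ⟨φ, hφ, hl⟩ := ha Unit (fun _ => ω) (fun _ => hωn) ε hε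
    refine ⟨ω.comp φ, ⟨φ, hφ, rfl⟩, ?_⟩
    have h1 := hl ()
    have h2 : ‖(show Car M →L[ℂ] ℂ from ρ) - ContinuousLinearMap.comp
        (show Car M →L[ℂ] ℂ from ω) φ‖ < ε := he ▸ h1
    rw [dist_eq_norm]
    exact h2
  refine ⟨⟨?_, ?_⟩, clo⟩
  · rintro ⟨ψ, -, -, -, hcl, rfl⟩
    have app : ∀ (x : Car M) (ε : ℝ), 0 < ε → ∃ φ : Car M →L[ℂ] Car M, IsE φ ∧
        ‖ω (ψ x) - ω (φ x)‖ < ε := by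
      intro x ε hε
      obtain ⟨φ, hφ, h⟩ := hcl ε hε 1 (fun _ => x) (fun _ => ω) (fun _ => hωn)
      exact ⟨φ, hφ, h 0 0⟩
    have key := easy_aux (M := M) (ω := ω) (ψ := ψ) app
    exact ⟨fun z hz => key.1 z (cen_of_center hz), fun c hc _ => mulNorm_le _ c fun x hx =>
      key.2 c (cen_of_center hc) (mulNorm ω c) (fun y hy => le_mulNorm ω c hy) x hx⟩
  · intro h
    obtain ⟨ψ, ha, hn, h1, he⟩ := exists_main ω ρ hωh hρh hωn hρn h
    refine ⟨ψ, hn, ha.cp, h1, ?_, he⟩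
    intro ε hε n x g hg
    obtain ⟨φ, hφ, hl⟩ := ha.pw ε hε n x g hg
    exact ⟨φ, hφ, hl⟩

end VonNeumannAlgebraPaper

end
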